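/- arXiv:1803.00856 — 2 statements merged into one kernel-verified Lean document; each statement's English description precedes it below -/
import Mathlib

section
/- Let k>0 and K ∈ C¹(ℝ²). Assume the function F(z) = ∫_{D_{1/k}(z)} K(q) dq has a stable critical point in a bounded open set A ⊂ ℝ². Then there exists ε₀>0 such that for every real ε with |ε|<ε₀ there exists an embedded Euclidean (k+εK)-loop, i.e. an embedded nonconstant C² 2π-periodic solution u : ℝ → ℝ² of u'' = L(u)(k+εK(u)) iu'. -/
open Real MeasureTheory Filter Topology

noncomputable section

/-- Rotation by π/2 in the plane: `iw = (-w₂, w₁)`. -/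
def rot (w : ℝ × ℝ) : ℝ × ℝ := (-w.2, w.1)

/-- Euclidean dot product in ℝ². -/
def dotp (v w : ℝ × ℝ) : ℝ := v.1 * w.1 + v.2 * w.2

/-- The length-type functional `L(u) = ((1/2π)∫₀^{2π} |u'|² dt)^{1/2}`. -/
def eucL (u : ℝ → ℝ × ℝ) : ℝ :=
  Real.sqrt ((1 / (2 * π)) * ∫ t in (0:ℝ)..(2 * π),
    ((deriv u t).1 ^ 2 + (deriv u t).2 ^ 2))

/-- `u` is a Euclidean `K`-loop: a nonconstant C² `2π`-periodic plane curve solving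
`u'' = L(u) K(u) iu'`; it then has Euclidean curvature `K(u(t))` at each point. -/
def IsELoop (K : (ℝ × ℝ) → ℝ) (u : ℝ → ℝ × ℝ) : Prop :=
  ContDiff ℝ 2 u ∧ Function.Periodic u (2 * π) ∧
  (¬ ∃ c, ∀ t, u t = c) ∧
  ∀ t, deriv (deriv u) t = (eucL u * K (u t)) • rot (deriv u t)

/-- A `2π`-periodic curve is embedded if it is injective modulo `2π`. -/
def IsEmbedded (u : ℝ → ℝ × ℝ) : Prop :=
  ∀ t s : ℝ, u t = u s → ∃ n : ℤ, t - s = 2 * π * (n : ℝ)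

/-- The Euclidean open disk of center `c` and radius `r` in `ℝ × ℝ`. -/
def EBall (c : ℝ × ℝ) (r : ℝ) : Set (ℝ × ℝ) :=
  {p : ℝ × ℝ | (p.1 - c.1) ^ 2 + (p.2 - c.2) ^ 2 < r ^ 2}

/-- The Euclidean Melnikov function `F(z) = ∫_{D_{1/k}(z)} K(q) dq`. -/
def FmelE (k : ℝ) (K : (ℝ × ℝ) → ℝ) (z : ℝ × ℝ) : ℝ :=
  ∫ q in EBall z (1 / k), K q

/-- `X` has a stable critical point in the bounded open set `A`: some `C¹`-neighborhood of
`X` consists of functions having a critical point in `A`. -/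
def HasStableCriticalPt (X : (ℝ × ℝ) → ℝ) (A : Set (ℝ × ℝ)) : Prop :=
  ∃ r > (0:ℝ), ∀ G : (ℝ × ℝ) → ℝ,
    (∃ U : Set (ℝ × ℝ), IsOpen U ∧ closure A ⊆ U ∧ ContDiffOn ℝ 1 G U) →
    (∀ z ∈ closure A, |G z - X z| + ‖fderiv ℝ G z - fderiv ℝ X z‖ < r) →
    ∃ z ∈ A, fderiv ℝ G z = 0

/-- The unit vector of angle `θ`. -/
def eDir (θ : ℝ) : ℝ × ℝ := (cos θ, sin θ)

@[fun_prop]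
lemma continuous_eDir : Continuous eDir := by unfold eDir; fun_prop

lemma norm_eDir_le (θ : ℝ) : ‖eDir θ‖ ≤ 1 := by
  simp only [eDir, Prod.norm_def, Real.norm_eq_abs]
  exact max_le (abs_cos_le_one θ) (abs_sin_le_one θ)

lemma hasDerivAt_eDir (θ : ℝ) : HasDerivAt eDir (rot (eDir θ)) θ :=
  (hasDerivAt_cos θ).prodMk (hasDerivAt_sin θ)

lemma HasDerivAt.fst_comp {u : ℝ → ℝ × ℝ} {v : ℝ × ℝ} {t : ℝ} (h : HasDerivAt u v t) :
    HasDerivAt (fun t => (u t).1) v.1 t :=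
  (ContinuousLinearMap.fst ℝ ℝ ℝ).hasFDerivAt.comp_hasDerivAt t h

lemma HasDerivAt.snd_comp {u : ℝ → ℝ × ℝ} {v : ℝ × ℝ} {t : ℝ} (h : HasDerivAt u v t) :
    HasDerivAt (fun t => (u t).2) v.2 t :=
  (ContinuousLinearMap.snd ℝ ℝ ℝ).hasFDerivAt.comp_hasDerivAt t h

/-- An arc of positive curvature turning by at most `π` is not closed. -/
lemma ne_of_turning_le_pi {u : ℝ → ℝ × ℝ} {g : ℝ → ℝ} (hg : ∀ θ, 0 < g θ)
    (hu : ∀ θ, HasDerivAt u (g θ • eDir θ) θ) {α β : ℝ} (hlt : α < β) (hle : β - α ≤ π) :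
    u α ≠ u β := by
  intro h
  set m := (α + β) / 2 with hm
  have hd : ∀ θ, HasDerivAt (fun θ => (u θ).1 * cos m + (u θ).2 * sin m)
      (g θ * cos (θ - m)) θ := by
    intro θ
    have h1 : HasDerivAt (fun θ => (u θ).1) (g θ * cos θ) θ :=
      (hu θ).fst_comp
    have h2 : HasDerivAt (fun θ => (u θ).2) (g θ * sin θ) θ :=
      (hu θ).snd_comp
    refine ((h1.mul_const (cos m)).add (h2.mul_const (sin m))).congr_deriv ?_
    rw [cos_sub]; ring
  have hmono : StrictMonoOn (fun θ => (u θ).1 * cos m + (u θ).2 * sin m) (Set.Icc α β) := by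
    refine strictMonoOn_of_deriv_pos (convex_Icc α β)
      (fun θ _ => (hd θ).continuousAt.continuousWithinAt) fun θ hθ => ?_
    rw [interior_Icc] at hθ
    rw [(hd θ).deriv]
    refine mul_pos (hg θ) (cos_pos_of_mem_Ioo ⟨?_, ?_⟩) <;> linarith [hθ.1, hθ.2]
  have := hmono (Set.left_mem_Icc.2 hlt.le) (Set.right_mem_Icc.2 hlt.le) hlt
  simp [h] at this

/-- A closed curve of positive curvature with total turning `2π` is simple. -/
lemma eq_mod_of_turning {u : ℝ → ℝ × ℝ} {g : ℝ → ℝ} (hg : ∀ θ, 0 < g θ)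
    (hu : ∀ θ, HasDerivAt u (g θ • eDir θ) θ) (hper : Function.Periodic u (2 * π))
    {α β : ℝ} (h : u α = u β) : ∃ n : ℤ, α = β + n * (2 * π) := by
  refine ⟨round ((α - β) / (2 * π)), ?_⟩
  set n := round ((α - β) / (2 * π)) with hn
  have hpi : 0 < 2 * π := by positivity
  have habs : |α - (β + n * (2 * π))| ≤ π := by
    have h1 := abs_sub_round ((α - β) / (2 * π))
    have h2 : α - (β + n * (2 * π)) = ((α - β) / (2 * π) - n) * (2 * π) := by
      field_simp; ring
    rw [h2, abs_mul, abs_of_pos hpi]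
    calc _ ≤ 1 / 2 * (2 * π) := by gcongr
      _ = π := by ring
  have hu' : u (β + n * (2 * π)) = u α := by rw [h]; exact (hper.int_mul n) β
  rcases lt_trichotomy α (β + n * (2 * π)) with hlt | heq | hlt
  · exact absurd hu'.symm (ne_of_turning_le_pi hg hu hlt (by linarith [(abs_le.1 habs).1]))
  · exact heq
  · exact absurd hu' (ne_of_turning_le_pi hg hu hlt (by linarith [(abs_le.1 habs).2]))

/-- A closed curve parametrized by its tangent angle, with positive curvature `κ`, becomes an
embedded `κ`-loop after reparametrization with constant speed. -/
lemma exists_loop_of_tangent_angle {u : ℝ → ℝ × ℝ} {κ : ℝ × ℝ → ℝ} (hκ : Continuous κ)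
    (hpos : ∀ θ, 0 < κ (u θ)) (hper : Function.Periodic u (2 * π))
    (hu : ∀ θ, HasDerivAt u ((κ (u θ))⁻¹ • eDir θ) θ) :
    ∃ w : ℝ → ℝ × ℝ, IsELoop κ w ∧ IsEmbedded w := by
  have hpi : 0 < 2 * π := by positivity
  have huc : Continuous u := continuous_iff_continuousAt.2 fun θ => (hu θ).continuousAt
  set g : ℝ → ℝ := fun θ => (κ (u θ))⁻¹ with hgdef
  have hg : ∀ θ, 0 < g θ := fun θ => inv_pos.2 (hpos θ)
  have hgc : Continuous g := (hκ.comp huc).inv₀ fun θ => (hpos θ).ne'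
  have hgper : Function.Periodic g (2 * π) := fun θ => by simp only [hgdef, hper θ]
  have hgi : ∀ a b, IntervalIntegrable g volume a b := fun a b => hgc.intervalIntegrable a b
  set s : ℝ → ℝ := fun θ => ∫ x in (0:ℝ)..θ, g x with hsdef
  have hs : ∀ θ, HasDerivAt s (g θ) θ := fun θ => hgc.integral_hasStrictDerivAt 0 θ |>.hasDerivAt
  have hsc : Continuous s := continuous_iff_continuousAt.2 fun θ => (hs θ).continuousAt
  have hsm : StrictMono s := strictMono_of_deriv_pos fun θ => by rw [(hs θ).deriv]; exact hg θ
  set S := s (2 * π) with hS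
  have hSpos : 0 < S := by
    have := hsm hpi
    simpa [hsdef] using this
  have hsurj : Function.Surjective s :=
    hsc.surjective (hgper.tendsto_atTop_intervalIntegral_of_pos hSpos hpi)
      (hgper.tendsto_atBot_intervalIntegral_of_pos hSpos hpi)
  have hsadd : ∀ θ, s (θ + 2 * π) = s θ + S := fun θ => by
    simpa [hsdef, hS] using hgper.intervalIntegral_add_eq_add 0 θ hgi
  set L := S / (2 * π) with hL
  have hLpos : 0 < L := div_pos hSpos hpi
  have hSL : S = L * (2 * π) := by rw [hL]; field_simp
  set inv := (hsm.orderIsoOfSurjective s hsurj).symm with hinv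
  have hsinv : ∀ x, s (inv x) = x := fun x =>
    (hsm.orderIsoOfSurjective s hsurj).apply_symm_apply x
  have hinvd : ∀ x, HasDerivAt inv (κ (u (inv x))) x := fun x => by
    have := HasDerivAt.of_local_left_inverse (f := s) (g := inv) (a := x)
      inv.continuous.continuousAt (hs (inv x)) (hg _).ne' (Eventually.of_forall hsinv)
    simpa [hgdef] using this
  set Θ : ℝ → ℝ := fun t => inv (L * t) with hΘ
  have hΘd : ∀ t, HasDerivAt Θ (L * κ (u (Θ t))) t := fun t => by
    have := (hinvd (L * t)).scomp t ((hasDerivAt_id t).const_mul L)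
    simpa [hΘ, Function.comp_def] using this
  have hΘc : Continuous Θ := continuous_iff_continuousAt.2 fun θ => (hΘd θ).continuousAt
  have hΘper : ∀ t, Θ (t + 2 * π) = Θ t + 2 * π := fun t => by
    apply hsm.injective
    rw [hsadd, hsinv, hsinv, hSL]; ring
  set w : ℝ → ℝ × ℝ := fun t => u (Θ t) with hw
  have hwd : ∀ t, HasDerivAt w (L • eDir (Θ t)) t := fun t => by
    have := (hu (Θ t)).scomp t (hΘd t)
    refine this.congr_deriv ?_
    rw [smul_smul, mul_assoc, mul_inv_cancel₀ (hpos _).ne', mul_one]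
  have hwd' : deriv w = fun t => L • eDir (Θ t) := funext fun t => (hwd t).deriv
  have hwdd : ∀ t, HasDerivAt (deriv w) ((L * κ (w t)) • rot (L • eDir (Θ t))) t := fun t => by
    rw [hwd']
    have := ((hasDerivAt_eDir (Θ t)).scomp t (hΘd t)).const_smul L
    refine this.congr_deriv ?_
    ext <;> simp [rot, eDir, hw] <;> ring
  have hwper : Function.Periodic w (2 * π) := fun t => by
    simp only [hw, hΘper]; exact hper _
  have hEL : eucL w = L := by
    have h1 : ∀ t, (deriv w t).1 ^ 2 + (deriv w t).2 ^ 2 = L ^ 2 := fun t => by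
      rw [hwd']; simp only [eDir, Prod.smul_fst, Prod.smul_snd, smul_eq_mul]
      linear_combination L ^ 2 * (cos_sq_add_sin_sq (Θ t))
    simp only [eucL, h1, intervalIntegral.integral_const, sub_zero, smul_eq_mul]
    rw [show 1 / (2 * π) * (2 * π * L ^ 2) = L ^ 2 by field_simp, sqrt_sq hLpos.le]
  refine ⟨w, ⟨?_, hwper, ?_, fun t => ?_⟩, fun t t' h => ?_⟩
  · have hrot : Continuous rot := by unfold rot; fun_prop
    have hwc : Continuous w := huc.comp hΘc
    rw [show (2 : WithTop ℕ∞) = 1 + 1 by norm_num, contDiff_succ_iff_deriv]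
    refine ⟨fun t => (hwd t).differentiableAt, by simp, ?_⟩
    rw [contDiff_one_iff_deriv]
    refine ⟨fun t => (hwdd t).differentiableAt, ?_⟩
    rw [show deriv (deriv w) = fun t => (L * κ (w t)) • rot (L • eDir (Θ t)) from
      funext fun t => (hwdd t).deriv]
    exact (continuous_const.mul (hκ.comp hwc)).smul
      (hrot.comp ((continuous_eDir.comp hΘc).const_smul L))
  · rintro ⟨c, hc⟩
    have h0 : deriv w 0 = 0 := by
      rw [show w = fun _ => c from funext hc]; simp
    rw [hwd'] at h0
    have h1 := congrArg Prod.fst h0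
    have h2 := congrArg Prod.snd h0
    simp only [eDir, Prod.smul_fst, Prod.smul_snd, smul_eq_mul, Prod.fst_zero, Prod.snd_zero,
      mul_eq_zero, hLpos.ne', false_or] at h1 h2
    have := cos_sq_add_sin_sq (Θ 0)
    rw [h1, h2] at this
    norm_num at this
  · rw [(hwdd t).deriv, hEL, hwd']
  · obtain ⟨n, hn⟩ := eq_mod_of_turning hg hu hper h
    refine ⟨n, ?_⟩
    have hQ : Function.Periodic (fun t => Θ t - t) (2 * π) := fun t => by
      simp only [hΘper]; ring
    have h1 := (hQ.int_mul n) t'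
    have h2 : Θ t = Θ (t' + n * (2 * π)) := by
      rw [hn]; linarith
    have h3 := inv.injective h2
    have h4 := mul_left_cancel₀ hLpos.ne' h3
    rw [h4]; ring

/-- The primitive of `K` in the first variable that vanishes on the vertical axis. -/
def xPrimitive (K : ℝ × ℝ → ℝ) (p : ℝ × ℝ) : ℝ := ∫ s in (0:ℝ)..p.1, K (s, p.2)

lemma continuous_xPrimitive {K : ℝ × ℝ → ℝ} (hK : Continuous K) : Continuous (xPrimitive K) := by
  have h1 : Continuous (Function.uncurry fun y s : ℝ => K (s, y)) := by
    unfold Function.uncurry; fun_prop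
  exact (intervalIntegral.continuous_parametric_primitive_of_continuous (μ := volume)
    (a₀ := 0) h1).comp continuous_swap

/-- The linear form `ζ ↦ a ζ₁ + b ζ₂`. -/
def coordForm (a b : ℝ) : ℝ × ℝ →L[ℝ] ℝ :=
  a • ContinuousLinearMap.fst ℝ ℝ ℝ + b • ContinuousLinearMap.snd ℝ ℝ ℝ

lemma coordForm_apply (a b : ℝ) (ζ : ℝ × ℝ) : coordForm a b ζ = a * ζ.1 + b * ζ.2 := by
  simp [coordForm]

lemma continuous_coordForm {X : Type*} [TopologicalSpace X] {f g : X → ℝ} (hf : Continuous f)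
    (hg : Continuous g) : Continuous fun x => coordForm (f x) (g x) := by
  unfold coordForm; fun_prop

lemma norm_coordForm_le (a b : ℝ) : ‖coordForm a b‖ ≤ |a| + |b| := by
  refine ContinuousLinearMap.opNorm_le_bound _ (by positivity) fun ζ => ?_
  rw [coordForm_apply, add_mul]
  refine (norm_add_le _ _).trans (add_le_add ?_ ?_) <;> rw [norm_mul, Real.norm_eq_abs]
  · exact mul_le_mul_of_nonneg_left (norm_fst_le ζ) (abs_nonneg _)
  · exact mul_le_mul_of_nonneg_left (norm_snd_le ζ) (abs_nonneg _)

/-- The primitive in the first variable of a Lipschitz `C¹` function is `C¹`. -/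
lemma hasFDerivAt_xPrimitive {K : ℝ × ℝ → ℝ} (hK : ContDiff ℝ 1 K) {M : NNReal}
    (hM : LipschitzWith M K) :
    ∃ g : ℝ × ℝ → ℝ, Continuous g ∧
      ∀ p, HasFDerivAt (xPrimitive K) (coordForm (K p) (g p)) p := by
  set ky : ℝ × ℝ → ℝ := fun p => fderiv ℝ K p (0, 1) with hky
  have hkyc : Continuous ky := (hK.continuous_fderiv one_ne_zero).clm_apply continuous_const
  have hgc : Continuous (xPrimitive ky) := continuous_xPrimitive hkyc
  refine ⟨xPrimitive ky, hgc, fun p => ?_⟩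
  have hbound : ∀ q, ‖ky q‖ ≤ M := fun q => by
    calc ‖ky q‖ ≤ ‖fderiv ℝ K q‖ * ‖((0 : ℝ), (1 : ℝ))‖ := ContinuousLinearMap.le_opNorm _ _
      _ ≤ M := by simpa using norm_fderiv_le_of_lipschitz ℝ hM
  have hdiff : ∀ s y, HasDerivAt (fun y => K (s, y)) (ky (s, y)) y := fun s y =>
    ((hK.differentiable one_ne_zero) (s, y)).hasFDerivAt.comp_hasDerivAt y
      ((hasDerivAt_const y s).prodMk (hasDerivAt_id y))
  have hKs : ∀ y, Continuous fun s => K (s, y) := fun y => by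
    have := hK.continuous; fun_prop
  have hx : ∀ v : ℝ × ℝ, HasDerivAt (fun x => xPrimitive K (x, v.2)) (K v) v.1 := fun v =>
    ((hKs v.2).integral_hasStrictDerivAt 0 v.1).hasDerivAt
  have hy : ∀ v : ℝ × ℝ, HasDerivAt (fun y => xPrimitive K (v.1, y)) (xPrimitive ky v) v.2 := by
    intro v
    refine (intervalIntegral.hasDerivAt_integral_of_dominated_loc_of_deriv_le
      (F := fun y s => K (s, y)) (F' := fun y s => ky (s, y)) (bound := fun _ => (M : ℝ))
      univ_mem (Eventually.of_forall fun y => (hKs y).aestronglyMeasurable)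
      ((hKs _).intervalIntegrable _ _) ?_ (Eventually.of_forall fun s _ y _ => hbound _)
      intervalIntegrable_const (Eventually.of_forall fun s _ y _ => hdiff s y)).2
    exact Continuous.aestronglyMeasurable (by fun_prop)
  have h := hasStrictFDerivAt_uncurry_coprod (𝕜 := ℝ) (u := p)
    (f := fun x y => xPrimitive K (x, y))
    (f₁ := fun x y => ContinuousLinearMap.toSpanSingleton ℝ (K (x, y)))
    (f₂ := fun x y => ContinuousLinearMap.toSpanSingleton ℝ (xPrimitive ky (x, y)))
    (Eventually.of_forall fun v => (hx v).hasFDerivAt)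
    (Eventually.of_forall fun v => (hy v).hasFDerivAt)
    ((ContinuousLinearMap.toSpanSingletonCLE (𝕜 := ℝ) (E := ℝ)).continuous.comp
      hK.continuous).continuousAt
    ((ContinuousLinearMap.toSpanSingletonCLE (𝕜 := ℝ) (E := ℝ)).continuous.comp
      hgc).continuousAt
  refine h.hasFDerivAt.congr_fderiv ?_
  ext <;> simp [coordForm, Function.HasUncurry.uncurry]

/-- First variation of `u ↦ ∫ Φ(u) u₂'` along a Lipschitz family of closed curves: only the
partial derivative `f = ∂₁Φ` enters. -/
lemma isLittleO_flux {Φ f g : ℝ × ℝ → ℝ} (hf : Continuous f) (hg : Continuous g)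
    (hΦ : ∀ p, HasFDerivAt Φ (coordForm (f p) (g p)) p) {v dv : ℝ × ℝ → ℝ → ℝ × ℝ} {C : ℝ}
    (hv : ∀ z θ, HasDerivAt (v z) (dv z θ) θ) (hdv : ∀ z, Continuous (dv z))
    (hper : ∀ z, Function.Periodic (v z) (2 * π))
    (hC : ∀ z z' θ, ‖v z θ - v z' θ‖ ≤ C * ‖z - z'‖)
    (hdC : ∀ z z' θ, ‖dv z θ - dv z' θ‖ ≤ C * ‖z - z'‖) (z₀ : ℝ × ℝ) :
    (fun z => (∫ θ in (0:ℝ)..(2 * π), Φ (v z θ) * (dv z θ).2)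
        - (∫ θ in (0:ℝ)..(2 * π), Φ (v z₀ θ) * (dv z₀ θ).2)
        - ∫ θ in (0:ℝ)..(2 * π), f (v z₀ θ) *
          ((v z θ - v z₀ θ).1 * (dv z₀ θ).2 - (v z θ - v z₀ θ).2 * (dv z₀ θ).1))
      =o[𝓝 z₀] fun z => z - z₀ := by
  have hpi : 0 < 2 * π := by positivity
  have hvc : ∀ z, Continuous (v z) := fun z =>
    continuous_iff_continuousAt.2 fun θ => (hv z θ).continuousAt
  have hΦc : Continuous Φ := continuous_iff_continuousAt.2 fun p => (hΦ p).continuousAt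
  have hC0 : 0 ≤ C := by
    have h := (norm_nonneg _).trans (hC (1, 0) 0 0)
    simpa using h
  have hcpt : IsCompact (v z₀ '' Set.Icc 0 (2 * π)) :=
    isCompact_Icc.image (hvc z₀)
  obtain ⟨D, hD⟩ := isCompact_Icc.exists_bound_of_continuousOn (s := Set.Icc 0 (2 * π))
    (hdv z₀).continuousOn
  obtain ⟨B, hB⟩ := hcpt.exists_bound_of_continuousOn (continuous_coordForm hf hg).continuousOn
  have hD0 : 0 ≤ D := (norm_nonneg _).trans (hD 0 ⟨le_rfl, hpi.le⟩)
  have hB0 : 0 ≤ B := (norm_nonneg _).trans (hB _ ⟨0, ⟨le_rfl, hpi.le⟩, rfl⟩)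
  -- the remainder as a single integral
  have hrem : ∀ z, (∫ θ in (0:ℝ)..(2 * π), Φ (v z θ) * (dv z θ).2)
        - (∫ θ in (0:ℝ)..(2 * π), Φ (v z₀ θ) * (dv z₀ θ).2)
        - (∫ θ in (0:ℝ)..(2 * π), f (v z₀ θ) *
          ((v z θ - v z₀ θ).1 * (dv z₀ θ).2 - (v z θ - v z₀ θ).2 * (dv z₀ θ).1))
      = ∫ θ in (0:ℝ)..(2 * π),
        ((Φ (v z θ) - Φ (v z₀ θ) - coordForm (f (v z₀ θ)) (g (v z₀ θ)) (v z θ - v z₀ θ))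
          * (dv z₀ θ).2 + (Φ (v z θ) - Φ (v z₀ θ)) * (dv z θ - dv z₀ θ).2) := by
    intro z
    have hz := hvc z
    have hz₀ := hvc z₀
    have hdz := hdv z
    have hdz₀ := hdv z₀
    have hparts : (∫ θ in (0:ℝ)..(2 * π),
        (coordForm (f (v z₀ θ)) (g (v z₀ θ)) (dv z₀ θ) * (v z θ - v z₀ θ).2
          + Φ (v z₀ θ) * (dv z θ - dv z₀ θ).2)) = 0 := by
      rw [intervalIntegral.integral_eq_sub_of_hasDerivAt
        (f := fun θ => Φ (v z₀ θ) * (v z θ - v z₀ θ).2)]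
      · have h1 := hper z 0
        have h2 := hper z₀ 0
        rw [zero_add] at h1 h2
        rw [h1, h2, sub_self]
      · intro θ _
        exact ((hΦ (v z₀ θ)).comp_hasDerivAt θ (hv z₀ θ)).mul
          ((hv z θ).sub (hv z₀ θ)).snd_comp
      · apply Continuous.intervalIntegrable
        simp only [coordForm_apply]
        fun_prop
    rw [← intervalIntegral.integral_sub, ← intervalIntegral.integral_sub]
    refine (sub_zero _).symm.trans ((congrArg (_ - ·) hparts.symm).trans ?_)
    rw [← intervalIntegral.integral_sub]
    · congr 1
      ext θ
      simp only [coordForm_apply, Prod.fst_sub, Prod.snd_sub]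
      ring
    all_goals
      apply Continuous.intervalIntegrable
      try simp only [coordForm_apply]
      fun_prop
  simp only [hrem]
  refine Asymptotics.isLittleO_iff.2 fun c hc => ?_
  obtain ⟨η, hη0, hη1, hη⟩ : ∃ η > 0, η ≤ 1 ∧ 2 * π * (η * C * D) ≤ c / 2 := by
    refine ⟨min 1 (c / 2 / (2 * π * (C * D) + 1)), by positivity, min_le_left _ _, ?_⟩
    have h1 : min 1 (c / 2 / (2 * π * (C * D) + 1)) ≤ c / 2 / (2 * π * (C * D) + 1) :=
      min_le_right _ _
    rw [le_div_iff₀ (by positivity)] at h1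
    have h2 : 0 ≤ min 1 (c / 2 / (2 * π * (C * D) + 1)) := by positivity
    nlinarith
  obtain ⟨r, hr0, hr⟩ : ∃ r > 0, ∀ x ∈ v z₀ '' Set.Icc 0 (2 * π), ∀ y ∈ Metric.ball x r,
      ‖fderiv ℝ Φ y - fderiv ℝ Φ x‖ ≤ η := by
    have hcont : Continuous (fderiv ℝ Φ) := by
      rw [show fderiv ℝ Φ = fun p => coordForm (f p) (g p) from
        funext fun p => (hΦ p).fderiv]
      exact continuous_coordForm hf hg
    have h := hcpt.uniformContinuousAt_of_continuousAt (fderiv ℝ Φ)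
      (fun a _ => hcont.continuousAt) (Metric.dist_mem_uniformity hη0)
    obtain ⟨r, hr0, hr⟩ := Metric.mem_uniformity_dist.1 h
    refine ⟨r, hr0, fun x hx y hy => ?_⟩
    have := hr (a := x) (b := y) (by rwa [dist_comm]) hx
    rw [← dist_eq_norm, dist_comm]
    exact le_of_lt this
  have hsmall : ∀ᶠ z in 𝓝 z₀, C * ‖z - z₀‖ < r ∧
      2 * π * ((1 + B) * C * (C * ‖z - z₀‖)) < c / 2 := by
    have h0 : Tendsto (fun z => ‖z - z₀‖) (𝓝 z₀) (𝓝 0) := by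
      have : Continuous fun z => ‖z - z₀‖ := by fun_prop
      simpa using this.tendsto z₀
    refine Eventually.and ?_ ?_
    · refine (h0.const_mul C).eventually_lt_const ?_
      simpa using hr0
    · refine ((((h0.const_mul C).const_mul ((1 + B) * C)).const_mul (2 * π))).eventually_lt_const ?_
      simpa using half_pos hc
  filter_upwards [hsmall] with z hz
  have hpt : ∀ θ ∈ Set.uIoc 0 (2 * π),
      ‖(Φ (v z θ) - Φ (v z₀ θ) - coordForm (f (v z₀ θ)) (g (v z₀ θ)) (v z θ - v z₀ θ))
          * (dv z₀ θ).2 + (Φ (v z θ) - Φ (v z₀ θ)) * (dv z θ - dv z₀ θ).2‖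
      ≤ (η * C * D + (1 + B) * C * (C * ‖z - z₀‖)) * ‖z - z₀‖ := by
    intro θ hθ
    rw [Set.uIoc_of_le hpi.le] at hθ
    have hθ' : θ ∈ Set.Icc 0 (2 * π) := ⟨hθ.1.le, hθ.2⟩
    have hmem : v z₀ θ ∈ v z₀ '' Set.Icc 0 (2 * π) := ⟨θ, hθ', rfl⟩
    have hh := hC z z₀ θ
    have h1 : ‖Φ (v z θ) - Φ (v z₀ θ) - coordForm (f (v z₀ θ)) (g (v z₀ θ)) (v z θ - v z₀ θ)‖
        ≤ η * (C * ‖z - z₀‖) := by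
      rw [← (hΦ (v z₀ θ)).fderiv]
      refine ((convex_ball (v z₀ θ) r).norm_image_sub_le_of_norm_fderiv_le'
        (fun y _ => (hΦ y).differentiableAt) (fun y hy => hr _ hmem y hy)
        (Metric.mem_ball_self hr0) ?_).trans (by gcongr)
      rw [mem_ball_iff_norm]
      exact hh.trans_lt hz.1
    have h2 : ‖Φ (v z θ) - Φ (v z₀ θ)‖ ≤ (1 + B) * (C * ‖z - z₀‖) := by
      have h3 : ‖coordForm (f (v z₀ θ)) (g (v z₀ θ)) (v z θ - v z₀ θ)‖ ≤ B * (C * ‖z - z₀‖) :=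
        (ContinuousLinearMap.le_opNorm _ _).trans
          (mul_le_mul (hB _ hmem) hh (norm_nonneg _) hB0)
      have h4 : η * (C * ‖z - z₀‖) ≤ 1 * (C * ‖z - z₀‖) := by gcongr
      have h5 := norm_sub_norm_le (Φ (v z θ) - Φ (v z₀ θ))
        (coordForm (f (v z₀ θ)) (g (v z₀ θ)) (v z θ - v z₀ θ))
      linarith
    refine (norm_add_le _ _).trans ?_
    rw [norm_mul, norm_mul, add_mul]
    have h6 : ‖(dv z₀ θ).2‖ ≤ D := (norm_snd_le _).trans (hD θ hθ')
    have h7 : ‖(dv z θ - dv z₀ θ).2‖ ≤ C * ‖z - z₀‖ := (norm_snd_le _).trans (hdC z z₀ θ)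
    refine add_le_add ?_ ?_
    · calc _ ≤ η * (C * ‖z - z₀‖) * D := by gcongr
        _ = _ := by ring
    · calc _ ≤ (1 + B) * (C * ‖z - z₀‖) * (C * ‖z - z₀‖) := by gcongr
        _ = _ := by ring
  refine (intervalIntegral.norm_integral_le_of_norm_le_const hpt).trans ?_
  rw [sub_zero, abs_of_pos hpi]
  nlinarith [norm_nonneg (z - z₀), hz.2]

/-- The circle of center `z` and radius `R`, parametrized by its tangent angle. -/
def circ (R : ℝ) (z : ℝ × ℝ) (θ : ℝ) : ℝ × ℝ := z + R • (sin θ, -cos θ)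

lemma hasDerivAt_circ (R : ℝ) (z : ℝ × ℝ) (θ : ℝ) :
    HasDerivAt (circ R z) (R • eDir θ) θ := by
  have h : HasDerivAt (fun θ => (sin θ, -cos θ)) (eDir θ) θ :=
    ((hasDerivAt_sin θ).prodMk (hasDerivAt_cos θ).neg).congr_deriv (by simp [eDir])
  exact (h.const_smul R).const_add z

@[fun_prop]
lemma continuous_circ (R : ℝ) (z : ℝ × ℝ) : Continuous (circ R z) := by
  unfold circ; fun_prop

lemma circ_periodic (R : ℝ) (z : ℝ × ℝ) : Function.Periodic (circ R z) (2 * π) := fun θ => by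
  simp [circ]

lemma integral_EBall_slice {K : ℝ × ℝ → ℝ} (hK : Continuous K) (z : ℝ × ℝ) (R y : ℝ) :
    ∫ x, (EBall z R).indicator K (x, y) =
      xPrimitive K (z.1 + √(R ^ 2 - (y - z.2) ^ 2), y)
        - xPrimitive K (z.1 - √(R ^ 2 - (y - z.2) ^ 2), y) := by
  set c := √(R ^ 2 - (y - z.2) ^ 2) with hc
  have hKy : Continuous fun x => K (x, y) := by fun_prop
  have h1 : (fun x => (EBall z R).indicator K (x, y))
      = (Set.Ioo (z.1 - c) (z.1 + c)).indicator fun x => K (x, y) := by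
    ext x
    have hiff : (x, y) ∈ EBall z R ↔ x ∈ Set.Ioo (z.1 - c) (z.1 + c) := by
      have h2 : |x - z.1| < c ↔ |x - z.1| ^ 2 < R ^ 2 - (y - z.2) ^ 2 :=
        Real.lt_sqrt (abs_nonneg _)
      rw [sq_abs, abs_lt] at h2
      simp only [EBall, Set.mem_ofPred_eq, Set.mem_Ioo]
      constructor
      · intro h
        have := h2.2 (by linarith)
        constructor <;> linarith [this.1, this.2]
      · intro h
        have := h2.1 ⟨by linarith [h.1], by linarith [h.2]⟩
        linarith
    by_cases hx : (x, y) ∈ EBall z R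
    · rw [Set.indicator_of_mem hx, Set.indicator_of_mem (hiff.1 hx)]
    · rw [Set.indicator_of_notMem hx, Set.indicator_of_notMem (hx ∘ hiff.2)]
  have hc0 : 0 ≤ c := Real.sqrt_nonneg _
  rw [h1, integral_indicator measurableSet_Ioo, ← integral_Ioc_eq_integral_Ioo,
    ← intervalIntegral.integral_of_le (by linarith)]
  exact (intervalIntegral.integral_interval_sub_left (hKy.intervalIntegrable _ _)
    (hKy.intervalIntegrable _ _)).symm

/-- Green's formula on a disk. -/
lemma integral_EBall_eq {K : ℝ × ℝ → ℝ} (hK : Continuous K) (z : ℝ × ℝ) {R : ℝ} (hR : 0 < R) :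
    ∫ q in EBall z R, K q =
      ∫ θ in (0:ℝ)..(2 * π), xPrimitive K (circ R z θ) * (R • eDir θ).2 := by
  have hopen : IsOpen (EBall z R) := by
    unfold EBall
    exact isOpen_lt (by fun_prop) (by fun_prop)
  have hsub : EBall z R ⊆ Metric.closedBall z R := fun p hp => by
    simp only [EBall, Set.mem_ofPred_eq] at hp
    rw [mem_closedBall_iff_norm, Prod.norm_def]
    refine max_le (abs_le_of_sq_le_sq ?_ hR.le) (abs_le_of_sq_le_sq ?_ hR.le)
    · simp only [Prod.fst_sub]; nlinarith [sq_nonneg (p.2 - z.2)]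
    · simp only [Prod.snd_sub]; nlinarith [sq_nonneg (p.1 - z.1)]
  have hintg : Integrable ((EBall z R).indicator K) (volume.prod volume) := by
    rw [← Measure.volume_eq_prod, integrable_indicator_iff hopen.measurableSet]
    exact (hK.continuousOn.integrableOn_compact (isCompact_closedBall z R)).mono_set hsub
  have hΦ := continuous_xPrimitive hK
  set H : ℝ → ℝ := fun y => xPrimitive K (z.1 + √(R ^ 2 - (y - z.2) ^ 2), y)
        - xPrimitive K (z.1 - √(R ^ 2 - (y - z.2) ^ 2), y) with hH
  have hHc : Continuous H := by fun_prop
  have hsupp : Function.support H ⊆ Set.Ioc (z.2 - R) (z.2 + R) := by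
    intro y hy
    by_contra hcon
    apply hy
    have h0 : R ^ 2 - (y - z.2) ^ 2 ≤ 0 := by
      rw [Set.mem_Ioc, not_and_or] at hcon
      rcases hcon with h | h <;> nlinarith
    simp only [hH, Real.sqrt_eq_zero_of_nonpos h0, add_zero, sub_zero, sub_self]
  have hcov := intervalIntegral.integral_comp_mul_deriv (a := 0) (b := π)
    (f := fun θ => z.2 - R * cos θ) (f' := fun θ => R * sin θ) (g := H)
    (fun θ _ => (((hasDerivAt_cos θ).const_mul R).const_sub z.2).congr_deriv (by ring))
    (by fun_prop) hHc
  have hfirst : ∀ a b, IntervalIntegrable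
      (fun θ => xPrimitive K (circ R z θ) * (R • eDir θ).2) volume a b := fun a b => by
    exact Continuous.intervalIntegrable (by fun_prop) a b
  have hrefl := intervalIntegral.integral_comp_sub_left (a := 0) (b := π)
    (fun θ => xPrimitive K (circ R z θ) * (R • eDir θ).2) (2 * π)
  rw [← integral_indicator hopen.measurableSet, Measure.volume_eq_prod,
    integral_prod_symm _ hintg]
  simp only [integral_EBall_slice hK]
  rw [← intervalIntegral.integral_eq_integral_of_support_subset hsupp]
  have e1 : z.2 - R * cos 0 = z.2 - R := by simp
  have e2 : z.2 - R * cos π = z.2 + R := by simp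
  rw [e1, e2] at hcov
  rw [← hcov, ← intervalIntegral.integral_add_adjacent_intervals (hfirst 0 π) (hfirst π (2 * π))]
  rw [show 2 * π - π = π by ring, sub_zero] at hrefl
  rw [← hrefl, ← intervalIntegral.integral_add (hfirst 0 π)]
  · refine intervalIntegral.integral_congr fun θ hθ => ?_
    rw [Set.uIcc_of_le pi_pos.le] at hθ
    have hs : √(R ^ 2 - (z.2 - R * cos θ - z.2) ^ 2) = R * sin θ := by
      rw [show R ^ 2 - (z.2 - R * cos θ - z.2) ^ 2 = (R * sin θ) ^ 2 by
        rw [mul_pow, sin_sq]; ring]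
      exact Real.sqrt_sq (mul_nonneg hR.le (sin_nonneg_of_mem_Icc hθ))
    have c1 : circ R z θ = (z.1 + R * sin θ, z.2 - R * cos θ) := by
      ext <;> simp [circ, sub_eq_add_neg]
    have c2 : circ R z (2 * π - θ) = (z.1 - R * sin θ, z.2 - R * cos θ) := by
      rw [circ, Real.sin_two_pi_sub, Real.cos_two_pi_sub]
      ext <;> simp [sub_eq_add_neg]
    simp only [hH, Function.comp, hs, c1, c2, eDir, Prod.smul_snd, smul_eq_mul,
      Real.sin_two_pi_sub]
    ring
  · exact Continuous.intervalIntegrable (by fun_prop) _ _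

/-- The gradient of the Melnikov function as a boundary integral. -/
lemma hasFDerivAt_FmelE {k : ℝ} (hk : 0 < k) {K : ℝ × ℝ → ℝ} (hK : ContDiff ℝ 1 K) {M : NNReal}
    (hM : LipschitzWith M K) (z : ℝ × ℝ) :
    HasFDerivAt (FmelE k K)
      (coordForm (k⁻¹ * ∫ θ in (0:ℝ)..(2 * π), K (circ k⁻¹ z θ) * sin θ)
        (-(k⁻¹ * ∫ θ in (0:ℝ)..(2 * π), K (circ k⁻¹ z θ) * cos θ))) z := by
  obtain ⟨g, hg, hΦ⟩ := hasFDerivAt_xPrimitive hK hM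
  have hF : FmelE k K = fun z =>
      ∫ θ in (0:ℝ)..(2 * π), xPrimitive K (circ k⁻¹ z θ) * (k⁻¹ • eDir θ).2 :=
    funext fun z => by
      rw [FmelE, one_div, integral_EBall_eq hK.continuous z (inv_pos.2 hk)]
  rw [hF, hasFDerivAt_iff_isLittleO]
  have h := isLittleO_flux (v := circ k⁻¹) (dv := fun _ θ => k⁻¹ • eDir θ) (C := 1)
    hK.continuous hg hΦ (fun z θ => hasDerivAt_circ k⁻¹ z θ)
    (fun _ => by fun_prop) (circ_periodic k⁻¹)
    (fun z z' θ => by simp [circ]) (fun z z' θ => by simp) z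
  refine h.congr_left fun z' => ?_
  congr 1
  have hc := hK.continuous
  have hdiff : ∀ θ, circ k⁻¹ z' θ - circ k⁻¹ z θ = z' - z := fun θ => by simp [circ]
  rw [coordForm_apply, neg_mul, ← sub_eq_add_neg, mul_assoc, mul_assoc,
    ← intervalIntegral.integral_mul_const, ← intervalIntegral.integral_mul_const,
    ← intervalIntegral.integral_const_mul, ← intervalIntegral.integral_const_mul,
    ← intervalIntegral.integral_sub]
  · congr 1
    ext θ
    simp only [hdiff, eDir, Prod.smul_fst, Prod.smul_snd, smul_eq_mul]
    ring
  all_goals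
    exact Continuous.intervalIntegrable (by fun_prop) _ _

lemma integral_eDir : ∫ θ in (0:ℝ)..(2 * π), eDir θ = 0 := by
  rw [intervalIntegral.integral_eq_sub_of_hasDerivAt (f := circ 1 0)
    (fun θ _ => by simpa using hasDerivAt_circ 1 0 θ) (continuous_eDir.intervalIntegrable _ _)]
  simp [circ]

lemma integral_circ (R : ℝ) (z : ℝ × ℝ) :
    ∫ θ in (0:ℝ)..(2 * π), circ R z θ = (2 * π) • z := by
  have hd : ∀ θ ∈ Set.uIcc 0 (2 * π),
      HasDerivAt (fun θ => θ • z - R • eDir θ) (circ R z θ) θ := fun θ _ => by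
    refine (((hasDerivAt_id θ).smul_const z).sub ((hasDerivAt_eDir θ).const_smul R)).congr_deriv ?_
    ext <;> simp [circ, rot, eDir, sub_eq_add_neg]
  rw [intervalIntegral.integral_eq_sub_of_hasDerivAt hd
    ((continuous_circ R z).intervalIntegrable _ _)]
  ext <;> simp [eDir]

/-- A periodic function with small derivative is close to its mean. -/
lemma norm_sub_mean_le {D dD : ℝ → ℝ × ℝ} {m : ℝ × ℝ} {c : ℝ}
    (hper : Function.Periodic D (2 * π)) (hD : ∀ θ, HasDerivAt D (dD θ) θ)
    (hc : ∀ θ, ‖dD θ‖ ≤ c) (hm : ∫ θ in (0:ℝ)..(2 * π), D θ = (2 * π) • m) (θ : ℝ) :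
    ‖D θ - m‖ ≤ 2 * π * c := by
  have hpi : 0 < 2 * π := by positivity
  have hc0 : 0 ≤ c := (norm_nonneg _).trans (hc 0)
  have hDc : Continuous D := continuous_iff_continuousAt.2 fun θ => (hD θ).continuousAt
  obtain ⟨α, hα, hαθ⟩ := hper.exists_mem_Ico₀ hpi θ
  rw [hαθ]
  have hlip : ∀ τ ∈ Set.uIoc 0 (2 * π), ‖D α - D τ‖ ≤ 2 * π * c := fun τ hτ => by
    rw [Set.uIoc_of_le hpi.le] at hτ
    have h := convex_univ.norm_image_sub_le_of_norm_hasDerivWithin_le (f := D) (f' := dD)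
      (fun x _ => (hD x).hasDerivWithinAt) (fun x _ => hc x) (Set.mem_univ τ) (Set.mem_univ α)
    refine h.trans ?_
    rw [mul_comm]
    refine mul_le_mul_of_nonneg_right (abs_le.2 ⟨?_, ?_⟩) hc0 <;>
      linarith [hα.1, hα.2, hτ.1, hτ.2]
  have h1 : (2 * π) • (D α - m) = ∫ τ in (0:ℝ)..(2 * π), (D α - D τ) := by
    rw [intervalIntegral.integral_sub intervalIntegrable_const (hDc.intervalIntegrable _ _), hm,
      intervalIntegral.integral_const, sub_zero, smul_sub]
  have h2 := intervalIntegral.norm_integral_le_of_norm_le_const hlip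
  rw [← h1, norm_smul, Real.norm_eq_abs, sub_zero, abs_of_pos hpi, mul_comm] at h2
  exact le_of_mul_le_mul_right h2 hpi

/-- The constant `a` for which `q(u)(e + a)` has zero mean. -/
def angleShift (q : ℝ × ℝ → ℝ) (u : ℝ → ℝ × ℝ) : ℝ × ℝ :=
  -((∫ θ in (0:ℝ)..(2 * π), q (u θ))⁻¹ • ∫ θ in (0:ℝ)..(2 * π), q (u θ) • eDir θ)

/-- The velocity field `q(u)(e + a)`. -/
def shiftedVelocity (q : ℝ × ℝ → ℝ) (u : ℝ → ℝ × ℝ) (θ : ℝ) : ℝ × ℝ :=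
  q (u θ) • (eDir θ + angleShift q u)

/-- The zero-mean primitive of `shiftedVelocity`, translated by `z`. -/
def shiftedCurve (q : ℝ × ℝ → ℝ) (z : ℝ × ℝ) (u : ℝ → ℝ × ℝ) (θ : ℝ) : ℝ × ℝ :=
  (∫ s in (0:ℝ)..θ, shiftedVelocity q u s) +
    (z - (2 * π)⁻¹ • ∫ τ in (0:ℝ)..(2 * π), ∫ s in (0:ℝ)..τ, shiftedVelocity q u s)

/-- `q` is `δ`-close to the constant `1/k` in the Lipschitz norm, with `δ` small. -/
structure NearConst (k δ : ℝ) (q : ℝ × ℝ → ℝ) : Prop where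
  k_pos : 0 < k
  delta_nonneg : 0 ≤ δ
  delta_mul_le : δ * (2 * k) ≤ 1
  delta_le : 64 * π * δ ≤ 1
  near : ∀ p, |q p - k⁻¹| ≤ δ
  lip : ∀ p p', |q p - q p'| ≤ δ * ‖p - p'‖

namespace NearConst

variable {k δ : ℝ} {q : ℝ × ℝ → ℝ}

lemma continuous (h : NearConst k δ q) : Continuous q :=
  (LipschitzWith.of_dist_le_mul (K := ⟨δ, h.delta_nonneg⟩) fun p p' => by
    rw [Real.dist_eq, dist_eq_norm]; exact h.lip p p').continuous

lemma delta_le_inv (h : NearConst k δ q) : δ ≤ k⁻¹ / 2 := by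
  have hk := h.k_pos
  have := h.delta_mul_le
  rw [le_div_iff₀ two_pos, ← one_div, le_div_iff₀ hk]
  linarith

lemma le_apply (h : NearConst k δ q) (p : ℝ × ℝ) : k⁻¹ / 2 ≤ q p := by
  linarith [h.delta_le_inv, (abs_le.1 (h.near p)).1]

lemma apply_pos (h : NearConst k δ q) (p : ℝ × ℝ) : 0 < q p :=
  (half_pos (inv_pos.2 h.k_pos)).trans_le (h.le_apply p)

lemma abs_apply_le (h : NearConst k δ q) (p : ℝ × ℝ) : |q p| ≤ 3 / 2 * k⁻¹ := by
  rw [abs_of_pos (h.apply_pos p)]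
  linarith [h.delta_le_inv, (abs_le.1 (h.near p)).2]

variable {u v : ℝ → ℝ × ℝ}

lemma pi_div_le_integral (h : NearConst k δ q) (hu : Continuous u) :
    π * k⁻¹ ≤ ∫ θ in (0:ℝ)..(2 * π), q (u θ) := by
  have hpi : 0 < 2 * π := by positivity
  have hqu := h.continuous.comp hu
  have := intervalIntegral.integral_mono_on hpi.le (intervalIntegrable_const (μ := volume))
    (hqu.intervalIntegrable 0 (2 * π)) fun θ _ => h.le_apply (u θ)
  rw [intervalIntegral.integral_const, sub_zero, smul_eq_mul] at this
  calc π * k⁻¹ = 2 * π * (k⁻¹ / 2) := by ring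
    _ ≤ _ := this

lemma integral_smul_angleShift (h : NearConst k δ q) (hu : Continuous u) :
    (∫ θ in (0:ℝ)..(2 * π), q (u θ)) • angleShift q u
      = -∫ θ in (0:ℝ)..(2 * π), q (u θ) • eDir θ := by
  have hk := h.k_pos
  have := h.pi_div_le_integral hu
  have hpos : 0 < ∫ θ in (0:ℝ)..(2 * π), q (u θ) := lt_of_lt_of_le (by positivity) this
  rw [angleShift, smul_neg, smul_smul, mul_inv_cancel₀ hpos.ne', one_smul]

lemma norm_integral_smul_eDir_le (h : NearConst k δ q) (hu : Continuous u) :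
    ‖∫ θ in (0:ℝ)..(2 * π), q (u θ) • eDir θ‖ ≤ 2 * π * δ := by
  have hqc := h.continuous
  have heq : ∫ θ in (0:ℝ)..(2 * π), q (u θ) • eDir θ
      = ∫ θ in (0:ℝ)..(2 * π), (q (u θ) - k⁻¹) • eDir θ := by
    simp only [sub_smul]
    rw [intervalIntegral.integral_sub, intervalIntegral.integral_smul, integral_eDir, smul_zero,
      sub_zero]
    all_goals exact Continuous.intervalIntegrable (by fun_prop) _ _
  have hpi : 0 < 2 * π := by positivity
  have := intervalIntegral.norm_integral_le_of_norm_le_const (a := 0) (b := 2 * π) (C := δ)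
    (f := fun θ => (q (u θ) - k⁻¹) • eDir θ) fun θ _ => by
      rw [norm_smul]
      exact (mul_le_mul (h.near (u θ)) (norm_eDir_le θ) (norm_nonneg _) h.delta_nonneg).trans_eq
        (mul_one δ)
  rw [heq]
  rwa [sub_zero, abs_of_pos hpi, mul_comm δ] at this

lemma norm_angleShift_le (h : NearConst k δ q) (hu : Continuous u) :
    ‖angleShift q u‖ ≤ 2 * k * δ := by
  have hk := h.k_pos
  have h1 := h.pi_div_le_integral hu
  have hpos : 0 < ∫ θ in (0:ℝ)..(2 * π), q (u θ) := lt_of_lt_of_le (by positivity) h1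
  have h2 := congrArg norm (h.integral_smul_angleShift hu)
  rw [norm_smul, norm_neg, Real.norm_eq_abs, abs_of_pos hpos] at h2
  have h3 := h.norm_integral_smul_eDir_le hu
  rw [← h2] at h3
  have h4 : π * k⁻¹ * ‖angleShift q u‖ ≤ 2 * π * δ :=
    (mul_le_mul_of_nonneg_right h1 (norm_nonneg _)).trans h3
  have h5 : π * k⁻¹ * ‖angleShift q u‖ ≤ π * k⁻¹ * (2 * k * δ) := by
    rw [show π * k⁻¹ * (2 * k * δ) = 2 * π * δ by field_simp]
    exact h4
  exact le_of_mul_le_mul_left h5 (by positivity)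

lemma norm_angleShift_le_one (h : NearConst k δ q) (hu : Continuous u) :
    ‖angleShift q u‖ ≤ 1 := by
  linarith [h.norm_angleShift_le hu, h.delta_mul_le]

lemma norm_angleShift_sub_le (h : NearConst k δ q) (hu : Continuous u) (hv : Continuous v) {d : ℝ}
    (hd : ∀ θ, ‖u θ - v θ‖ ≤ d) :
    ‖angleShift q u - angleShift q v‖ ≤ 4 * k * δ * d := by
  have hk := h.k_pos
  have hδ := h.delta_nonneg
  have hd0 : 0 ≤ d := (norm_nonneg _).trans (hd 0)
  have hpi : 0 < 2 * π := by positivity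
  have hqc := h.continuous
  have hdiff : ∀ θ, |q (v θ) - q (u θ)| ≤ δ * d := fun θ => by
    rw [abs_sub_comm]
    exact (h.lip _ _).trans (mul_le_mul_of_nonneg_left (hd θ) hδ)
  have hkey : (∫ θ in (0:ℝ)..(2 * π), q (u θ)) • (angleShift q u - angleShift q v)
      = ∫ θ in (0:ℝ)..(2 * π), (q (v θ) - q (u θ)) • (eDir θ + angleShift q v) := by
    have hsplit : ∫ θ in (0:ℝ)..(2 * π), (q (v θ) - q (u θ)) • (eDir θ + angleShift q v)
        = ((∫ θ in (0:ℝ)..(2 * π), q (v θ) • eDir θ) - ∫ θ in (0:ℝ)..(2 * π), q (u θ) • eDir θ)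
          + ((∫ θ in (0:ℝ)..(2 * π), q (v θ)) - ∫ θ in (0:ℝ)..(2 * π), q (u θ)) •
            angleShift q v := by
      rw [← intervalIntegral.integral_sub, ← intervalIntegral.integral_sub,
        ← intervalIntegral.integral_smul_const, ← intervalIntegral.integral_add]
      · congr 1; ext1 θ; rw [smul_add, sub_smul]
      all_goals exact Continuous.intervalIntegrable (by fun_prop) _ _
    rw [hsplit, smul_sub, sub_smul, h.integral_smul_angleShift hu, h.integral_smul_angleShift hv]
    abel
  have h1 := h.pi_div_le_integral hu
  have hpos : 0 < ∫ θ in (0:ℝ)..(2 * π), q (u θ) := lt_of_lt_of_le (by positivity) h1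
  have h2 := intervalIntegral.norm_integral_le_of_norm_le_const (a := 0) (b := 2 * π)
    (C := δ * d * 2) (f := fun θ => (q (v θ) - q (u θ)) • (eDir θ + angleShift q v)) fun θ _ => by
      rw [norm_smul]
      refine mul_le_mul (hdiff θ) ?_ (norm_nonneg _) (by positivity)
      linarith [norm_add_le (eDir θ) (angleShift q v), norm_eDir_le θ, h.norm_angleShift_le_one hv]
  rw [← hkey, norm_smul, Real.norm_eq_abs, abs_of_pos hpos, sub_zero, abs_of_pos hpi] at h2
  have h3 : π * k⁻¹ * ‖angleShift q u - angleShift q v‖ ≤ π * k⁻¹ * (4 * k * δ * d) := by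
    refine (mul_le_mul_of_nonneg_right h1 (norm_nonneg _)).trans (h2.trans_eq ?_)
    field_simp; ring
  exact le_of_mul_le_mul_left h3 (by positivity)

lemma norm_shiftedVelocity_sub_le (h : NearConst k δ q) (hu : Continuous u) (hv : Continuous v)
    {d : ℝ} (hd : ∀ θ, ‖u θ - v θ‖ ≤ d) (θ : ℝ) :
    ‖shiftedVelocity q u θ - shiftedVelocity q v θ‖ ≤ 8 * δ * d := by
  have hk := h.k_pos
  have hδ := h.delta_nonneg
  have hd0 : 0 ≤ d := (norm_nonneg _).trans (hd 0)
  have heq : shiftedVelocity q u θ - shiftedVelocity q v θ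
      = (q (u θ) - q (v θ)) • (eDir θ + angleShift q v)
        + q (u θ) • (angleShift q u - angleShift q v) := by
    simp only [shiftedVelocity, smul_add, sub_smul, smul_sub]; abel
  have h1 : ‖(q (u θ) - q (v θ)) • (eDir θ + angleShift q v)‖ ≤ δ * d * 2 := by
    rw [norm_smul]
    refine mul_le_mul ((h.lip _ _).trans (mul_le_mul_of_nonneg_left (hd θ) hδ)) ?_
      (norm_nonneg _) (by positivity)
    linarith [norm_add_le (eDir θ) (angleShift q v), norm_eDir_le θ, h.norm_angleShift_le_one hv]
  have h2 : ‖q (u θ) • (angleShift q u - angleShift q v)‖ ≤ 3 / 2 * k⁻¹ * (4 * k * δ * d) := by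
    rw [norm_smul]
    exact mul_le_mul (h.abs_apply_le _) (h.norm_angleShift_sub_le hu hv hd) (norm_nonneg _)
      (by positivity)
  have h3 : 3 / 2 * k⁻¹ * (4 * k * δ * d) = 6 * δ * d := by field_simp; ring
  rw [heq]
  linarith [norm_add_le ((q (u θ) - q (v θ)) • (eDir θ + angleShift q v))
    (q (u θ) • (angleShift q u - angleShift q v))]

lemma norm_shiftedVelocity_sub_eDir_le (h : NearConst k δ q) (hu : Continuous u) (θ : ℝ) :
    ‖shiftedVelocity q u θ - k⁻¹ • eDir θ‖ ≤ 4 * δ := by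
  have hk := h.k_pos
  have hδ := h.delta_nonneg
  have heq : shiftedVelocity q u θ - k⁻¹ • eDir θ
      = (q (u θ) - k⁻¹) • (eDir θ + angleShift q u) + k⁻¹ • angleShift q u := by
    simp only [shiftedVelocity, smul_add, sub_smul]; abel
  have h1 : ‖(q (u θ) - k⁻¹) • (eDir θ + angleShift q u)‖ ≤ δ * 2 := by
    rw [norm_smul]
    refine mul_le_mul (h.near _) ?_ (norm_nonneg _) hδ
    linarith [norm_add_le (eDir θ) (angleShift q u), norm_eDir_le θ, h.norm_angleShift_le_one hu]
  have h2 : ‖k⁻¹ • angleShift q u‖ ≤ k⁻¹ * (2 * k * δ) := by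
    rw [norm_smul, Real.norm_eq_abs, abs_of_pos (inv_pos.2 hk)]
    exact mul_le_mul_of_nonneg_left (h.norm_angleShift_le hu) (inv_pos.2 hk).le
  have h3 : k⁻¹ * (2 * k * δ) = 2 * δ := by field_simp
  rw [heq]
  linarith [norm_add_le ((q (u θ) - k⁻¹) • (eDir θ + angleShift q u)) (k⁻¹ • angleShift q u)]

lemma continuous_shiftedVelocity (h : NearConst k δ q) (hu : Continuous u) :
    Continuous (shiftedVelocity q u) := by
  have := h.continuous
  unfold shiftedVelocity; fun_prop

lemma integral_shiftedVelocity (h : NearConst k δ q) (hu : Continuous u) :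
    ∫ θ in (0:ℝ)..(2 * π), shiftedVelocity q u θ = 0 := by
  have := h.continuous
  simp only [shiftedVelocity, smul_add]
  rw [intervalIntegral.integral_add, intervalIntegral.integral_smul_const,
    h.integral_smul_angleShift hu, add_neg_cancel]
  all_goals exact Continuous.intervalIntegrable (by fun_prop) _ _

lemma hasDerivAt_shiftedCurve (h : NearConst k δ q) (hu : Continuous u) (z : ℝ × ℝ) (θ : ℝ) :
    HasDerivAt (shiftedCurve q z u) (shiftedVelocity q u θ) θ :=
  ((h.continuous_shiftedVelocity hu).integral_hasStrictDerivAt 0 θ).hasDerivAt.add_const _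

lemma continuous_shiftedCurve (h : NearConst k δ q) (hu : Continuous u) (z : ℝ × ℝ) :
    Continuous (shiftedCurve q z u) :=
  continuous_iff_continuousAt.2 fun θ => (h.hasDerivAt_shiftedCurve hu z θ).continuousAt

lemma shiftedCurve_periodic (h : NearConst k δ q) (hu : Continuous u)
    (hper : Function.Periodic u (2 * π)) (z : ℝ × ℝ) :
    Function.Periodic (shiftedCurve q z u) (2 * π) := fun θ => by
  have hp : Function.Periodic (shiftedVelocity q u) (2 * π) := fun θ => by
    simp [shiftedVelocity, hper θ, eDir]
  have := hp.intervalIntegral_add_eq_add 0 θ fun a b =>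
    (h.continuous_shiftedVelocity hu).intervalIntegrable a b
  rw [zero_add, h.integral_shiftedVelocity hu, add_zero] at this
  rw [shiftedCurve, this, shiftedCurve]

lemma integral_shiftedCurve (h : NearConst k δ q) (hu : Continuous u) (z : ℝ × ℝ) :
    ∫ θ in (0:ℝ)..(2 * π), shiftedCurve q z u θ = (2 * π) • z := by
  have hpi : 2 * π ≠ 0 := by positivity
  have hc : Continuous fun θ => ∫ s in (0:ℝ)..θ, shiftedVelocity q u s :=
    continuous_iff_continuousAt.2 fun θ =>
      ((h.continuous_shiftedVelocity hu).integral_hasStrictDerivAt 0 θ).hasDerivAt.continuousAt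
  simp only [shiftedCurve]
  rw [intervalIntegral.integral_add (hc.intervalIntegrable _ _) intervalIntegrable_const,
    intervalIntegral.integral_const, sub_zero, smul_sub, smul_smul, mul_inv_cancel₀ hpi, one_smul]
  abel

lemma norm_shiftedCurve_sub_le (h : NearConst k δ q) (hu : Continuous u) (hv : Continuous v)
    (hup : Function.Periodic u (2 * π)) (hvp : Function.Periodic v (2 * π)) {d : ℝ}
    (hd : ∀ θ, ‖u θ - v θ‖ ≤ d) (z z' : ℝ × ℝ) (θ : ℝ) :
    ‖shiftedCurve q z u θ - shiftedCurve q z' v θ‖ ≤ ‖z - z'‖ + d / 4 := by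
  have hd0 : 0 ≤ d := (norm_nonneg _).trans (hd 0)
  have h1 := norm_sub_mean_le (D := fun θ => shiftedCurve q z u θ - shiftedCurve q z' v θ)
    (m := z - z')
    (fun θ => by
      simp only [h.shiftedCurve_periodic hu hup z θ, h.shiftedCurve_periodic hv hvp z' θ])
    (fun θ => (h.hasDerivAt_shiftedCurve hu z θ).sub (h.hasDerivAt_shiftedCurve hv z' θ))
    (h.norm_shiftedVelocity_sub_le hu hv hd)
    (by
      rw [intervalIntegral.integral_sub, h.integral_shiftedCurve hu, h.integral_shiftedCurve hv,
        smul_sub]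
      · exact (h.continuous_shiftedCurve hu z).intervalIntegrable _ _
      · exact (h.continuous_shiftedCurve hv z').intervalIntegrable _ _) θ
  have h2 : 2 * π * (8 * δ * d) ≤ d / 4 := by nlinarith [h.delta_le]
  have h3 := norm_sub_norm_le (shiftedCurve q z u θ - shiftedCurve q z' v θ) (z - z')
  linarith

lemma exists_fixedPoint (h : NearConst k δ q) (z : ℝ × ℝ) :
    ∃ u : ℝ → ℝ × ℝ, Continuous u ∧ Function.Periodic u (2 * π) ∧ shiftedCurve q z u = u := by
  have hclosed : IsClosed {u : BoundedContinuousFunction ℝ (ℝ × ℝ) |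
      Function.Periodic u (2 * π)} := by
    simp only [Function.Periodic, Set.ofPred_forall]
    exact isClosed_iInter fun θ => isClosed_eq
      (continuous_eval_const (θ + 2 * π))
      (continuous_eval_const θ)
  have := hclosed.completeSpace_coe
  let S := {u : BoundedContinuousFunction ℝ (ℝ × ℝ) // Function.Periodic u (2 * π)}
  have : CompleteSpace S := this
  have hper : ∀ u : S, Function.Periodic (shiftedCurve q z u.1) (2 * π) := fun u =>
    h.shiftedCurve_periodic u.1.continuous u.2 z
  have hcont : ∀ u : S, Continuous (shiftedCurve q z u.1) := fun u =>
    h.continuous_shiftedCurve u.1.continuous z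
  let T : S → S := fun u => ⟨⟨⟨shiftedCurve q z u.1, hcont u⟩,
    Metric.isBounded_range_iff.1
      ((hper u).isBounded_of_continuous (by positivity) (hcont u))⟩, hper u⟩
  have hT : ContractingWith (1 / 4) T := by
    refine ⟨by rw [← NNReal.coe_lt_coe]; norm_num, LipschitzWith.of_dist_le_mul fun u v => ?_⟩
    refine (BoundedContinuousFunction.dist_le (by positivity)).2 fun θ => ?_
    have h1 := h.norm_shiftedCurve_sub_le u.1.continuous v.1.continuous u.2 v.2
      (d := dist u v) (fun θ => by
        rw [← dist_eq_norm]; exact BoundedContinuousFunction.dist_coe_le_dist θ) z z θ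
    rw [dist_eq_norm]
    refine h1.trans_eq ?_
    rw [sub_self, norm_zero]
    push_cast
    ring
  have : Nonempty S := ⟨⟨0, fun θ => rfl⟩⟩
  refine ⟨(hT.fixedPoint T).1, (hT.fixedPoint T).1.continuous, (hT.fixedPoint T).2, ?_⟩
  have h2 := hT.fixedPoint_isFixedPt
  exact congrArg (fun u : S => (u.1 : ℝ → ℝ × ℝ)) h2

/-- The center-parametrized family of almost solutions: closed curves with
`u' = q(u)(e + a)`, `a` constant, and prescribed mean. -/
lemma exists_family (h : NearConst k δ q) :
    ∃ u : ℝ × ℝ → ℝ → ℝ × ℝ, (∀ z, Continuous (u z)) ∧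
      (∀ z, Function.Periodic (u z) (2 * π)) ∧
      (∀ z θ, HasDerivAt (u z) (shiftedVelocity q (u z) θ) θ) ∧
      (∀ z, ∫ θ in (0:ℝ)..(2 * π), u z θ = (2 * π) • z) ∧
      (∀ z z' θ, ‖u z θ - u z' θ‖ ≤ 2 * ‖z - z'‖) ∧
      (∀ z θ, ‖u z θ - circ k⁻¹ z θ‖ ≤ 8 * π * δ) := by
  choose u hu hper hfix using h.exists_fixedPoint
  have hd : ∀ z θ, HasDerivAt (u z) (shiftedVelocity q (u z) θ) θ := fun z θ => by
    have := h.hasDerivAt_shiftedCurve (hu z) z θ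
    rwa [hfix] at this
  have hmean : ∀ z, ∫ θ in (0:ℝ)..(2 * π), u z θ = (2 * π) • z := fun z => by
    have := h.integral_shiftedCurve (hu z) z
    rwa [hfix] at this
  refine ⟨u, hu, hper, hd, hmean, fun z z' => ?_, fun z θ => ?_⟩
  · have hb : BddAbove (Set.range fun θ => ‖u z θ - u z' θ‖) := by
      have hp : Function.Periodic (fun θ => ‖u z θ - u z' θ‖) (2 * π) := fun θ => by
        simp only [hper z θ, hper z' θ]
      exact (hp.isBounded_of_continuous (by positivity) ((hu z).sub (hu z')).norm).bddAbove
    have h1 : ∀ θ, ‖u z θ - u z' θ‖ ≤ ⨆ θ, ‖u z θ - u z' θ‖ := fun θ => le_ciSup hb θ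
    have h2 : ⨆ θ, ‖u z θ - u z' θ‖ ≤ ‖z - z'‖ + (⨆ θ, ‖u z θ - u z' θ‖) / 4 :=
      ciSup_le fun θ => by
        have := h.norm_shiftedCurve_sub_le (hu z) (hu z') (hper z) (hper z') h1 z z' θ
        rwa [hfix, hfix] at this
    intro θ
    linarith [h1 θ, norm_nonneg (z - z')]
  · have := norm_sub_mean_le (D := fun θ => u z θ - circ k⁻¹ z θ) (m := 0)
      (fun θ => by simp only [hper z θ, circ_periodic k⁻¹ z θ])
      (fun θ => (hd z θ).sub (hasDerivAt_circ k⁻¹ z θ))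
      (h.norm_shiftedVelocity_sub_eDir_le (hu z))
      (by
        rw [intervalIntegral.integral_sub ((hu z).intervalIntegrable _ _)
          ((continuous_circ k⁻¹ z).intervalIntegrable _ _), hmean, integral_circ, sub_self,
          smul_zero]) θ
    rw [sub_zero] at this
    linarith

end NearConst

lemma nearConst_inv {k ε M : ℝ} {K : ℝ × ℝ → ℝ} (hk : 0 < k) (hb : ∀ p, |K p| ≤ M)
    (hl : ∀ p p', |K p - K p'| ≤ M * ‖p - p'‖) (hε : 8 * (|ε| * M) ≤ k)
    (hδ : 64 * π * (4 * (|ε| * M) / k ^ 2) ≤ 1) :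
    NearConst k (4 * (|ε| * M) / k ^ 2) (fun p => (k + ε * K p)⁻¹) := by
  have hM : 0 ≤ M := (abs_nonneg _).trans (hb 0)
  have hεM : 0 ≤ |ε| * M := by positivity
  have hKε : ∀ p, |ε * K p| ≤ |ε| * M := fun p => by
    rw [abs_mul]; exact mul_le_mul_of_nonneg_left (hb p) (abs_nonneg _)
  have hlow : ∀ p, k / 2 ≤ k + ε * K p := fun p => by
    linarith [(abs_le.1 (hKε p)).1]
  have hpos : ∀ p, 0 < k + ε * K p := fun p => by linarith [hlow p]
  refine ⟨hk, by positivity, ?_, hδ, fun p => ?_, fun p p' => ?_⟩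
  · rw [div_mul_eq_mul_div, div_le_one (by positivity)]
    nlinarith
  · have h1 : (k + ε * K p)⁻¹ - k⁻¹ = -(ε * K p) / ((k + ε * K p) * k) := by
      have := (hpos p).ne'
      field_simp
      ring
    rw [h1, abs_div, abs_neg, abs_of_pos (mul_pos (hpos p) hk), div_le_div_iff₀
      (mul_pos (hpos p) hk) (by positivity)]
    have h2 : k ^ 2 ≤ 4 * ((k + ε * K p) * k) := by nlinarith [hlow p]
    calc |ε * K p| * k ^ 2 ≤ (|ε| * M) * (4 * ((k + ε * K p) * k)) :=
          mul_le_mul (hKε p) h2 (by positivity) hεM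
      _ = _ := by ring
  · have h1 : (k + ε * K p)⁻¹ - (k + ε * K p')⁻¹ =
        -(ε * (K p - K p')) / ((k + ε * K p) * (k + ε * K p')) := by
      have := (hpos p).ne'
      have := (hpos p').ne'
      field_simp
      ring
    rw [h1, abs_div, abs_neg, abs_of_pos (mul_pos (hpos p) (hpos p')), div_mul_eq_mul_div,
      div_le_div_iff₀ (mul_pos (hpos p) (hpos p')) (by positivity), abs_mul]
    have h2 : k ^ 2 ≤ 4 * ((k + ε * K p) * (k + ε * K p')) := by
      nlinarith [mul_le_mul (hlow p) (hlow p') (by positivity) (hpos p).le]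
    calc |ε| * |K p - K p'| * k ^ 2
        ≤ (|ε| * (M * ‖p - p'‖)) * (4 * ((k + ε * K p) * (k + ε * K p'))) :=
          mul_le_mul (mul_le_mul_of_nonneg_left (hl p p') (abs_nonneg _)) h2 (by positivity)
            (by positivity)
      _ = _ := by ring

/-- The reduced functional: the flux of the curvature form minus the support-type term whose
derivative balances it along curves with tangent direction `eDir`. -/
def reducedFunctional (Φ q : ℝ × ℝ → ℝ) (u : ℝ × ℝ → ℝ → ℝ × ℝ) (z : ℝ × ℝ) : ℝ :=
  (∫ θ in (0:ℝ)..(2 * π), Φ (u z θ) * (shiftedVelocity q (u z) θ).2) -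
    ∫ θ in (0:ℝ)..(2 * π), ((u z θ).1 * sin θ - (u z θ).2 * cos θ)

lemma NearConst.hasFDerivAt_reducedFunctional {k δ : ℝ} {q Φ κ g : ℝ × ℝ → ℝ}
    (h : NearConst k δ q) (hκ : Continuous κ) (hg : Continuous g) (hκq : ∀ p, κ p * q p = 1)
    (hΦ : ∀ p, HasFDerivAt Φ (coordForm (κ p) (g p)) p) {u : ℝ × ℝ → ℝ → ℝ × ℝ}
    (huc : ∀ z, Continuous (u z)) (hper : ∀ z, Function.Periodic (u z) (2 * π))
    (hu : ∀ z θ, HasDerivAt (u z) (shiftedVelocity q (u z) θ) θ)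
    (hmean : ∀ z, ∫ θ in (0:ℝ)..(2 * π), u z θ = (2 * π) • z)
    (hlip : ∀ z z' θ, ‖u z θ - u z' θ‖ ≤ 2 * ‖z - z'‖) (z₀ : ℝ × ℝ) :
    HasFDerivAt (reducedFunctional Φ q u)
      (coordForm (2 * π * (angleShift q (u z₀)).2) (-(2 * π * (angleShift q (u z₀)).1))) z₀ := by
  have hδ := h.delta_nonneg
  have hflux := isLittleO_flux hκ hg hΦ (v := u) (dv := fun z => shiftedVelocity q (u z))
    (C := 2 + 16 * δ) hu (fun z => h.continuous_shiftedVelocity (huc z)) hper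
    (fun z z' θ => (hlip z z' θ).trans
      (mul_le_mul_of_nonneg_right (by linarith) (norm_nonneg _)))
    (fun z z' θ => (h.norm_shiftedVelocity_sub_le (huc z) (huc z') (hlip z z') θ).trans
      (by nlinarith [norm_nonneg (z - z')])) z₀
  rw [hasFDerivAt_iff_isLittleO]
  refine hflux.congr_left fun z => ?_
  set a := angleShift q (u z₀) with ha
  have hintg : ∀ θ, κ (u z₀ θ) * ((u z θ - u z₀ θ).1 * (shiftedVelocity q (u z₀) θ).2 -
      (u z θ - u z₀ θ).2 * (shiftedVelocity q (u z₀) θ).1) =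
      (((u z θ).1 * sin θ - (u z θ).2 * cos θ) - ((u z₀ θ).1 * sin θ - (u z₀ θ).2 * cos θ)) +
        coordForm a.2 (-a.1) (u z θ - u z₀ θ) := fun θ => by
    have := hκq (u z₀ θ)
    simp only [shiftedVelocity, ← ha, coordForm_apply, eDir, Prod.smul_fst, Prod.smul_snd,
      Prod.fst_add, Prod.snd_add, Prod.fst_sub, Prod.snd_sub, smul_eq_mul]
    linear_combination (((u z θ).1 - (u z₀ θ).1) * (sin θ + a.2) -
      ((u z θ).2 - (u z₀ θ).2) * (cos θ + a.1)) * this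
  have hc := huc z
  have hc₀ := huc z₀
  have hform : ∫ θ in (0:ℝ)..(2 * π), coordForm a.2 (-a.1) (u z θ - u z₀ θ) =
      coordForm (2 * π * a.2) (-(2 * π * a.1)) (z - z₀) := by
    rw [ContinuousLinearMap.intervalIntegral_comp_comm (f := fun θ => u z θ - u z₀ θ) _
      ((hc.sub hc₀).intervalIntegrable _ _), intervalIntegral.integral_sub
      (hc.intervalIntegrable _ _) (hc₀.intervalIntegrable _ _), hmean, hmean, ← smul_sub]
    simp only [coordForm_apply, Prod.smul_fst, Prod.smul_snd, smul_eq_mul]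
    ring
  simp only [reducedFunctional]
  rw [intervalIntegral.integral_congr (fun θ _ => hintg θ), intervalIntegral.integral_add,
    intervalIntegral.integral_sub, hform]
  · ring
  all_goals apply Continuous.intervalIntegrable; fun_prop

/-- First-order expansion in `ε` of the angle shift along curves close to a circle. -/
lemma norm_angleShift_sub_melnikov_le {k ε M : ℝ} {K : ℝ × ℝ → ℝ} (hKc : Continuous K)
    (hb : ∀ p, |K p| ≤ M) (hl : ∀ p p', |K p - K p'| ≤ M * ‖p - p'‖) {δ : ℝ}
    (hδ : 4 * (|ε| * M) = δ * k ^ 2) (hpos : ∀ p, 0 < k + ε * K p)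
    (h : NearConst k δ (fun p => (k + ε * K p)⁻¹))
    {u : ℝ → ℝ × ℝ} (hu : Continuous u) {z : ℝ × ℝ}
    (hclose : ∀ θ, ‖u θ - circ k⁻¹ z θ‖ ≤ 8 * π * δ) :
    ‖(2 * π) • angleShift (fun p => (k + ε * K p)⁻¹) u -
      (ε * k⁻¹) • ∫ θ in (0:ℝ)..(2 * π), K (circ k⁻¹ z θ) • eDir θ‖ ≤
      (4 * π * k ^ 2 + 2 * π * k * (k / 4 + 2 * π)) * δ ^ 2 := by
  have hk := h.k_pos
  have hδ0 := h.delta_nonneg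
  have hpi := pi_pos
  set q : ℝ × ℝ → ℝ := fun p => (k + ε * K p)⁻¹ with hq
  have hqc : Continuous q := h.continuous
  set a := angleShift q u with ha
  set D := ∫ θ in (0:ℝ)..(2 * π), q (u θ) with hD
  have hDa : D • a = -∫ θ in (0:ℝ)..(2 * π), q (u θ) • eDir θ := h.integral_smul_angleShift hu
  have hDclose : |2 * π - k * D| ≤ 2 * π * k * δ := by
    have h1 : 2 * π * k⁻¹ - D = ∫ θ in (0:ℝ)..(2 * π), (k⁻¹ - q (u θ)) := by
      rw [intervalIntegral.integral_sub intervalIntegrable_const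
        (Continuous.intervalIntegrable (by fun_prop) _ _), intervalIntegral.integral_const,
        sub_zero, smul_eq_mul]
    have h2 : |2 * π * k⁻¹ - D| ≤ δ * |2 * π - 0| := by
      rw [h1, ← Real.norm_eq_abs]
      refine intervalIntegral.norm_integral_le_of_norm_le_const fun θ _ => ?_
      rw [Real.norm_eq_abs, abs_sub_comm]
      exact h.near _
    rw [sub_zero, abs_of_pos two_pi_pos] at h2
    have h3 : 2 * π - k * D = k * (2 * π * k⁻¹ - D) := by
      field_simp
    rw [h3, abs_mul, abs_of_pos hk]
    nlinarith
  have hsecond : D • a - (ε * (k⁻¹) ^ 2) • ∫ θ in (0:ℝ)..(2 * π), K (circ k⁻¹ z θ) • eDir θ =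
      ∫ θ in (0:ℝ)..(2 * π),
        ((k⁻¹ - q (u θ)) - ε * (k⁻¹) ^ 2 * K (circ k⁻¹ z θ)) • eDir θ := by
    have h0 : ∫ θ in (0:ℝ)..(2 * π), k⁻¹ • eDir θ = 0 := by
      rw [intervalIntegral.integral_smul, integral_eDir, smul_zero]
    rw [hDa, ← intervalIntegral.integral_smul, ← zero_sub, ← h0,
      ← intervalIntegral.integral_sub, ← intervalIntegral.integral_sub]
    · congr 1 with θ <;> simp <;> ring
    all_goals apply Continuous.intervalIntegrable; fun_prop
  have hpt : ∀ θ, ‖((k⁻¹ - q (u θ)) - ε * (k⁻¹) ^ 2 * K (circ k⁻¹ z θ)) • eDir θ‖ ≤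
      (k / 4 + 2 * π) * δ ^ 2 := fun θ => by
    have h1 : (k⁻¹ - q (u θ)) - ε * (k⁻¹) ^ 2 * K (circ k⁻¹ z θ) =
        ε * K (u θ) * k⁻¹ * (q (u θ) - k⁻¹) +
          ε * (k⁻¹) ^ 2 * (K (u θ) - K (circ k⁻¹ z θ)) := by
      have := (hpos (u θ)).ne'
      simp only [hq]
      field_simp
      ring
    have hεM : |ε| * M = δ * k ^ 2 / 4 := by linarith
    have h2 : |ε * K (u θ) * k⁻¹ * (q (u θ) - k⁻¹)| ≤ |ε| * M * k⁻¹ * δ := by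
      rw [abs_mul, abs_mul, abs_mul, abs_of_pos (inv_pos.2 hk)]
      have := hb (u θ)
      have := h.near (u θ)
      have : 0 ≤ M := (abs_nonneg _).trans (hb 0)
      gcongr
    have h3 : |ε * (k⁻¹) ^ 2 * (K (u θ) - K (circ k⁻¹ z θ))| ≤
        |ε| * (k⁻¹) ^ 2 * (M * (8 * π * δ)) := by
      rw [abs_mul, abs_mul, abs_of_pos (pow_pos (inv_pos.2 hk) 2)]
      have : 0 ≤ M := (abs_nonneg _).trans (hb 0)
      have := (hl (u θ) (circ k⁻¹ z θ)).trans (mul_le_mul_of_nonneg_left (hclose θ) this)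
      gcongr
    rw [norm_smul, h1, Real.norm_eq_abs]
    refine (mul_le_of_le_one_right (abs_nonneg _) (norm_eDir_le θ)).trans ?_
    refine (abs_add_le _ _).trans ((add_le_add h2 h3).trans (le_of_eq ?_))
    rw [show |ε| * (k⁻¹) ^ 2 * (M * (8 * π * δ)) = (|ε| * M) * (k⁻¹) ^ 2 * (8 * π * δ) by ring,
      hεM]
    field_simp
    ring
  have hintg := intervalIntegral.norm_integral_le_of_norm_le_const (a := 0) (b := 2 * π)
    (fun θ _ => hpt θ)
  rw [← hsecond, sub_zero, abs_of_pos (by positivity)] at hintg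
  have hsplit : (2 * π) • a - (ε * k⁻¹) • ∫ θ in (0:ℝ)..(2 * π), K (circ k⁻¹ z θ) • eDir θ =
      (2 * π - k * D) • a + k • (D • a -
        (ε * (k⁻¹) ^ 2) • ∫ θ in (0:ℝ)..(2 * π), K (circ k⁻¹ z θ) • eDir θ) := by
    rw [smul_sub, smul_smul, smul_smul, sub_smul,
      show k * (ε * (k⁻¹) ^ 2) = ε * k⁻¹ by field_simp]
    abel
  rw [hsplit]
  refine (norm_add_le _ _).trans ?_
  rw [norm_smul, norm_smul, Real.norm_eq_abs, Real.norm_eq_abs, abs_of_pos hk]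
  have h1 := mul_le_mul hDclose (h.norm_angleShift_le hu) (norm_nonneg _) (by positivity)
  have h2 := mul_le_mul_of_nonneg_left hintg hk.le
  calc _ ≤ _ := add_le_add h1 h2
    _ = _ := by ring

/-- Lyapunov-Schmidt reduction: for small `ε ≠ 0` the almost circular `(k + ε K)`-loops correspond
to critical points of a function that is `C¹`-close to the Melnikov function. -/
lemma exists_reduction {k M : ℝ} {K : ℝ × ℝ → ℝ} (hk : 0 < k) (hK : ContDiff ℝ 1 K)
    (hb : ∀ p, |K p| ≤ M) (hl : ∀ p p', |K p - K p'| ≤ M * ‖p - p'‖) :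
    ∃ ε₁ > (0:ℝ), ∃ C : ℝ, ∀ ε : ℝ, ε ≠ 0 → |ε| < ε₁ →
      (∀ p, 0 < k + ε * K p) ∧ ∃ (u : ℝ × ℝ → ℝ → ℝ × ℝ) (G : ℝ × ℝ → ℝ),
        (∀ z, Function.Periodic (u z) (2 * π)) ∧
        (∀ z θ, ‖u z θ - circ k⁻¹ z θ‖ ≤ 1) ∧ ContDiff ℝ 1 G ∧ G 0 = FmelE k K 0 ∧
        (∀ z, ‖fderiv ℝ G z - fderiv ℝ (FmelE k K) z‖ ≤ C * |ε|) ∧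
        ∀ z, fderiv ℝ G z = 0 → ∀ θ, HasDerivAt (u z) ((k + ε * K (u z θ))⁻¹ • eDir θ) θ := by
  have hM : 0 ≤ M := (abs_nonneg _).trans (hb 0)
  have hpi := pi_pos
  have hLip : LipschitzWith ⟨M, hM⟩ K := LipschitzWith.of_dist_le_mul fun p p' => by
    rw [Real.dist_eq, dist_eq_norm]; exact hl p p'
  obtain ⟨g, hg, hΨ⟩ := hasFDerivAt_xPrimitive hK hLip
  set B := 4 * π * k ^ 2 + 2 * π * k * (k / 4 + 2 * π) with hB
  have hB0 : 0 < B := by positivity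
  refine ⟨min (k / (8 * (M + 1))) (k ^ 2 / (256 * π * (M + 1))), by positivity,
    2 * B * (4 * M / k ^ 2) ^ 2, fun ε hε0 hε => ?_⟩
  have hεpos : 0 < |ε| := abs_pos.2 hε0
  have hε1 : 8 * (|ε| * M) ≤ k := by
    have := hε.le.trans (min_le_left _ _)
    rw [le_div_iff₀ (by positivity)] at this
    nlinarith
  have hε2 : 64 * π * (4 * (|ε| * M) / k ^ 2) ≤ 1 := by
    have := hε.le.trans (min_le_right _ _)
    rw [le_div_iff₀ (by positivity)] at this
    rw [← mul_div_assoc, div_le_one (by positivity)]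
    nlinarith [mul_pos hpi hεpos]
  have hnear := nearConst_inv hk hb hl hε1 hε2
  have hpos : ∀ p, 0 < k + ε * K p := fun p => inv_pos.1 (hnear.apply_pos p)
  refine ⟨hpos, ?_⟩
  set δ := 4 * (|ε| * M) / k ^ 2 with hδ
  have hδk : 4 * (|ε| * M) = δ * k ^ 2 := by rw [hδ]; field_simp
  set q : ℝ × ℝ → ℝ := fun p => (k + ε * K p)⁻¹ with hq
  obtain ⟨u, huc, hper, hu, hmean, hlip, hclose⟩ := hnear.exists_family
  set Φ : ℝ × ℝ → ℝ := fun p => k * p.1 + ε * xPrimitive K p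
  have hΦ : ∀ p, HasFDerivAt Φ (coordForm (k + ε * K p) (ε * g p)) p := fun p => by
    refine ((hasFDerivAt_fst.const_mul k).add ((hΨ p).const_mul ε)).congr_fderiv ?_
    ext <;> simp [coordForm_apply]
  have hKc := hK.continuous
  have hJ := hnear.hasFDerivAt_reducedFunctional (κ := fun p => k + ε * K p)
    (g := fun p => ε * g p) (by fun_prop) (by fun_prop)
    (fun p => mul_inv_cancel₀ (hpos p).ne') hΦ huc hper hu hmean hlip
  set a : ℝ × ℝ → ℝ × ℝ := fun z => angleShift q (u z) with ha
  have hac : Continuous a := by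
    refine (LipschitzWith.of_dist_le_mul (K := ⟨4 * k * δ * 2, ?_⟩) fun z z' => ?_).continuous
    · have := hnear.delta_nonneg
      positivity
    · rw [dist_eq_norm, dist_eq_norm]
      refine (hnear.norm_angleShift_sub_le (huc z) (huc z') (hlip z z')).trans
        (mul_assoc (4 * k * δ) 2 ‖z - z'‖).ge
  set J := reducedFunctional Φ q u with hJdef
  set G : ℝ × ℝ → ℝ := fun z => ε⁻¹ * (J z - J 0) + FmelE k K 0 with hG
  have hGd : ∀ z, HasFDerivAt G
      (coordForm (ε⁻¹ * (2 * π * (a z).2)) (-(ε⁻¹ * (2 * π * (a z).1)))) z := fun z => by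
    refine ((((hJ z).sub_const _).const_mul ε⁻¹).add_const _).congr_fderiv ?_
    ext <;> simp [coordForm_apply, ha]
  refine ⟨u, G, hper, fun z θ => (hclose z θ).trans ?_, ?_, by simp [hG], fun z => ?_,
    fun z hz θ => ?_⟩
  · have := hnear.delta_le
    nlinarith [mul_nonneg hpi.le hnear.delta_nonneg]
  · rw [contDiff_one_iff_fderiv]
    refine ⟨fun z => (hGd z).differentiableAt, ?_⟩
    rw [funext fun z => (hGd z).fderiv]
    exact continuous_coordForm (by fun_prop) (by fun_prop)
  · have hest := norm_angleShift_sub_melnikov_le hKc hb hl hδk hpos hnear (huc z) (hclose z)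
    rw [(hGd z).fderiv, (hasFDerivAt_FmelE hk hK hLip z).fderiv]
    set w := (2 * π) • angleShift q (u z) -
      (ε * k⁻¹) • ∫ θ in (0:ℝ)..(2 * π), K (circ k⁻¹ z θ) • eDir θ with hw
    have hintg : IntervalIntegrable (fun θ => K (circ k⁻¹ z θ) • eDir θ) volume 0 (2 * π) := by
      apply Continuous.intervalIntegrable; fun_prop
    have hw1 : w.1 = 2 * π * (a z).1 -
        ε * k⁻¹ * ∫ θ in (0:ℝ)..(2 * π), K (circ k⁻¹ z θ) * cos θ := by
      have h1 := (ContinuousLinearMap.fst ℝ ℝ ℝ).intervalIntegral_comp_comm hintg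
      simp only [ContinuousLinearMap.coe_fst', Prod.smul_fst, eDir, smul_eq_mul] at h1
      simp only [hw, Prod.fst_sub, Prod.smul_fst, smul_eq_mul, h1, eDir, ha]
    have hw2 : w.2 = 2 * π * (a z).2 -
        ε * k⁻¹ * ∫ θ in (0:ℝ)..(2 * π), K (circ k⁻¹ z θ) * sin θ := by
      have h1 := (ContinuousLinearMap.snd ℝ ℝ ℝ).intervalIntegral_comp_comm hintg
      simp only [ContinuousLinearMap.coe_snd', Prod.smul_snd, eDir, smul_eq_mul] at h1
      simp only [hw, Prod.snd_sub, Prod.smul_snd, smul_eq_mul, h1, eDir, ha]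
    have hdiff : coordForm (ε⁻¹ * (2 * π * (a z).2)) (-(ε⁻¹ * (2 * π * (a z).1))) -
        coordForm (k⁻¹ * ∫ θ in (0:ℝ)..(2 * π), K (circ k⁻¹ z θ) * sin θ)
          (-(k⁻¹ * ∫ θ in (0:ℝ)..(2 * π), K (circ k⁻¹ z θ) * cos θ)) =
        coordForm (ε⁻¹ * w.2) (-(ε⁻¹ * w.1)) := by
      rw [hw1, hw2]
      ext <;> simp [coordForm_apply] <;> field_simp
      ring
    rw [hdiff]
    refine (norm_coordForm_le _ _).trans ?_
    rw [abs_neg, abs_mul, abs_mul, abs_inv]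
    have h1 : |w.1| ≤ B * δ ^ 2 := (norm_fst_le w).trans hest
    have h2 : |w.2| ≤ B * δ ^ 2 := (norm_snd_le w).trans hest
    calc |ε|⁻¹ * |w.2| + |ε|⁻¹ * |w.1| ≤ |ε|⁻¹ * (B * δ ^ 2) + |ε|⁻¹ * (B * δ ^ 2) := by gcongr
      _ = _ := by rw [hδ]; field_simp; ring
  · rw [(hGd z).fderiv] at hz
    have h1 := congrArg (fun L => L ((1, 0) : ℝ × ℝ)) hz
    have h2 := congrArg (fun L => L ((0, 1) : ℝ × ℝ)) hz
    have ha0 : a z = 0 := by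
      ext
      · simpa [coordForm_apply, hε0, hpi.ne'] using h2
      · simpa [coordForm_apply, hε0, hpi.ne'] using h1
    have h3 := hu z θ
    rwa [shiftedVelocity, show angleShift q (u z) = 0 from ha0, add_zero] at h3

/-- A `C¹` function on the plane agrees on any ball with a bounded, Lipschitz `C¹` function. -/
lemma exists_cutoff {K : ℝ × ℝ → ℝ} (hK : ContDiff ℝ 1 K) {R : ℝ} (hR : 0 < R) :
    ∃ (K' : ℝ × ℝ → ℝ) (M : ℝ), ContDiff ℝ 1 K' ∧ (∀ p, |K' p| ≤ M) ∧
      (∀ p p', |K' p - K' p'| ≤ M * ‖p - p'‖) ∧ ∀ p, ‖p‖ ≤ R → K' p = K p := by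
  let χ : ContDiffBump (0 : ℝ × ℝ) := ⟨R, R + 1, hR, by linarith⟩
  have hC : ContDiff ℝ 1 (fun p => χ p * K p) := χ.contDiff.mul hK
  have hs : HasCompactSupport (fun p => χ p * K p) := χ.hasCompactSupport.mul_right
  obtain ⟨M₁, hM₁⟩ := hs.exists_bound_of_continuous hC.continuous
  obtain ⟨M₂, hM₂⟩ := hC.lipschitzWith_of_hasCompactSupport hs one_ne_zero
  refine ⟨fun p => χ p * K p, max M₁ M₂, hC, fun p => (hM₁ p).trans (le_max_left _ _),
    fun p p' => ?_, fun p hp => ?_⟩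
  · have h := hM₂.dist_le_mul p p'
    rw [Real.dist_eq, dist_eq_norm] at h
    exact h.trans (mul_le_mul_of_nonneg_right (le_max_right _ _) (norm_nonneg _))
  · have : χ p = 1 := χ.one_of_mem_closedBall (by simpa [χ] using hp)
    simp [this]

lemma FmelE_congr {k R : ℝ} (hk : 0 < k) {K K' : ℝ × ℝ → ℝ}
    (h : ∀ p, ‖p‖ ≤ R → K' p = K p) {z : ℝ × ℝ} (hz : ‖z‖ + k⁻¹ ≤ R) :
    FmelE k K' z = FmelE k K z := by
  refine setIntegral_congr_fun ?_ fun p hp => h p ?_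
  · exact (isOpen_lt (by fun_prop) continuous_const).measurableSet
  · have hp' : (p.1 - z.1) ^ 2 + (p.2 - z.2) ^ 2 < (k⁻¹) ^ 2 := by simpa [EBall] using hp
    have h0 : 0 ≤ k⁻¹ := (inv_pos.2 hk).le
    have h1 : ‖p - z‖ ≤ k⁻¹ := by
      refine norm_prod_le_iff.2 ⟨abs_le_of_sq_le_sq ?_ h0, abs_le_of_sq_le_sq ?_ h0⟩
      · simp only [Prod.fst_sub]; nlinarith [sq_nonneg (p.2 - z.2)]
      · simp only [Prod.snd_sub]; nlinarith [sq_nonneg (p.1 - z.1)]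
    calc ‖p‖ = ‖z + (p - z)‖ := by rw [add_sub_cancel]
      _ ≤ ‖z‖ + ‖p - z‖ := norm_add_le _ _
      _ ≤ R := by linarith

lemma norm_circ_sub_le {R : ℝ} (hR : 0 ≤ R) (z : ℝ × ℝ) (θ : ℝ) : ‖circ R z θ - z‖ ≤ R := by
  rw [circ, add_sub_cancel_left, norm_smul, Real.norm_eq_abs, abs_of_nonneg hR]
  refine mul_le_of_le_one_right hR (norm_prod_le_iff.2 ⟨abs_sin_le_one θ, ?_⟩)
  rw [norm_neg]
  exact abs_cos_le_one θ

/-- Euclidean existence: if `F(z) = ∫_{D_{1/k}(z)} K` has a stable critical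
point in a bounded open set `A ⊂ ℝ²`, then for every `ε` close enough to `0` there exists
an embedded Euclidean `(k+εK)`-loop. -/
theorem stmt_17 (k : ℝ) (hk : 0 < k) (K : (ℝ × ℝ) → ℝ)
    (hK : ContDiff ℝ 1 K)
    (A : Set (ℝ × ℝ)) (hAo : IsOpen A) (hAb : Bornology.IsBounded A)
    (hstab : HasStableCriticalPt (FmelE k K) A) :
    ∃ ε₀ > (0:ℝ), ∀ ε : ℝ, |ε| < ε₀ →
      ∃ u : ℝ → ℝ × ℝ, IsELoop (fun z => k + ε * K z) u ∧ IsEmbedded u := by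
  obtain ⟨r, hr, hstab⟩ := hstab
  obtain ⟨ρ, hρ, hAρ⟩ := hAb.closure.subset_ball_lt 0 0
  have hki : 0 < k⁻¹ := inv_pos.2 hk
  obtain ⟨K', M, hK', hb, hl, hKK'⟩ := exists_cutoff hK (R := ρ + k⁻¹ + 1) (by positivity)
  obtain ⟨ε₁, hε₁, C, hred⟩ := exists_reduction hk hK' hb hl
  have hLip : LipschitzWith ⟨M, (abs_nonneg _).trans (hb 0)⟩ K' :=
    LipschitzWith.of_dist_le_mul fun p p' => by
      rw [Real.dist_eq, dist_eq_norm]; exact hl p p'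
  have hF' : ∀ z, DifferentiableAt ℝ (FmelE k K') z := fun z =>
    (hasFDerivAt_FmelE hk hK' hLip z).differentiableAt
  have hFF' : Set.EqOn (FmelE k K') (FmelE k K) (Metric.ball 0 ρ) := fun z hz =>
    FmelE_congr hk hKK' (by linarith [mem_ball_zero_iff.1 hz])
  refine ⟨min ε₁ (r / ((|C| + 1) * (ρ + 1))), by positivity, fun ε hε => ?_⟩
  rcases eq_or_ne ε 0 with rfl | hε0
  · refine exists_loop_of_tangent_angle (u := circ k⁻¹ 0) (by fun_prop) (fun θ => by simpa)
      (circ_periodic _ _) fun θ => ?_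
    simpa using hasDerivAt_circ k⁻¹ 0 θ
  obtain ⟨hpos, u, G, hper, hclose, hGC, hG0, hGF, hcrit⟩ :=
    hred ε hε0 (hε.trans_le (min_le_left _ _))
  have hCε : C * |ε| * (ρ + 1) < r := by
    have h1 := hε.trans_le (min_le_right _ _)
    rw [lt_div_iff₀ (by positivity)] at h1
    refine lt_of_le_of_lt ?_ h1
    have h2 : C * (|ε| * (ρ + 1)) ≤ (|C| + 1) * (|ε| * (ρ + 1)) :=
      mul_le_mul_of_nonneg_right (by linarith [le_abs_self C]) (by positivity)
    linarith
  have hval : ∀ z, |G z - FmelE k K' z| ≤ C * |ε| * ‖z‖ := fun z => by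
    have hd : ∀ x ∈ Set.univ, HasFDerivWithinAt (fun z => G z - FmelE k K' z)
        (fderiv ℝ G x - fderiv ℝ (FmelE k K') x) Set.univ x := fun x _ =>
      (((hGC.differentiable one_ne_zero x).hasFDerivAt).sub (hF' x).hasFDerivAt).hasFDerivWithinAt
    have h := convex_univ.norm_image_sub_le_of_norm_hasFDerivWithin_le hd (fun x _ => hGF x)
      (Set.mem_univ 0) (Set.mem_univ z)
    simpa [hG0] using h
  obtain ⟨z, hzA, hz⟩ := hstab G ⟨Set.univ, isOpen_univ, Set.subset_univ _, hGC.contDiffOn⟩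
    fun z hz => by
      have hzρ := hAρ hz
      rw [← hFF' hzρ, ← (hFF'.eventuallyEq_of_mem (Metric.isOpen_ball.mem_nhds hzρ)).fderiv_eq]
      have hC0 : 0 ≤ C * |ε| := (norm_nonneg _).trans (hGF z)
      have h1 := mul_le_mul_of_nonneg_left (mem_ball_zero_iff.1 hzρ).le hC0
      linarith [hval z, hGF z]
  have hKu : ∀ θ, K' (u z θ) = K (u z θ) := fun θ => hKK' _ <| by
    have h1 := mem_ball_zero_iff.1 (hAρ (subset_closure hzA))
    have h2 := norm_circ_sub_le hki.le z θ
    calc ‖u z θ‖ = ‖z + (circ k⁻¹ z θ - z) + (u z θ - circ k⁻¹ z θ)‖ := by congr 1; abel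
      _ ≤ ‖z‖ + ‖circ k⁻¹ z θ - z‖ + ‖u z θ - circ k⁻¹ z θ‖ := norm_add₃_le
      _ ≤ _ := by linarith [hclose z θ]
  have hKc := hK.continuous
  refine exists_loop_of_tangent_angle (u := u z) (by fun_prop) (fun θ => ?_) (hper z) fun θ => ?_
  · rw [← hKu]; exact hpos _
  · rw [← hKu]; exact hcrit z hz θ
end
end

section
/- Let k>0 and ω(t) = (1/k)(cos t, sin t). A C² 2π-periodic function φ : ℝ → ℝ² satisfies −φ'' + iφ' − k²((1/2π)∫₀^{2π} φ·ω dt)ω = 0 identically on ℝ if and only if φ is a real linear combination of the three functions ω', (1,0), and (0,1). (That is, the kernel of the linearization at ω of the Euclidean constant-curvature-k loop equation coincides with the span of ω', e₁, e₂.) -/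
open Real MeasureTheory Filter Topology

noncomputable section

/-- The reference circle of radius `1/k` in the Euclidean plane. -/
def omE (k : ℝ) (t : ℝ) : ℝ × ℝ := ((1 / k) * cos t, (1 / k) * sin t)

theorem integral_dotp_omE (k A B b c : ℝ) (φ : ℝ → ℝ × ℝ)
    (h : ∀ t, φ t = (A * sin t + B * cos t + b, -(A * cos t) + B * sin t + c)) :
    ∫ s in (0 : ℝ)..(2 * π), dotp (φ s) (omE k s) = 2 * π * ((1 / k) * B) := by
  have integrand : ∀ s, dotp (φ s) (omE k s) =
      (1 / k) * B + ((1 / k) * b * cos s + (1 / k) * c * sin s) := by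
    intro s
    rw [h s]
    simp only [dotp, omE]
    linear_combination (1 / k) * B * sin_sq_add_cos_sq s
  simp_rw [integrand]
  rw [intervalIntegral.integral_add (by simp)
      (Continuous.intervalIntegrable (by fun_prop) _ _),
    intervalIntegral.integral_add (Continuous.intervalIntegrable (by fun_prop) _ _)
      (Continuous.intervalIntegrable (by fun_prop) _ _)]
  simp [mul_left_comm]

theorem hasDerivAt_omE (k t : ℝ) :
    HasDerivAt (omE k) (-((1 / k) * sin t), (1 / k) * cos t) t := by
  have h := ((hasDerivAt_cos t).const_mul (1 / k)).prodMk ((hasDerivAt_sin t).const_mul (1 / k))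
  rw [mul_neg] at h
  exact h

theorem hasDerivAt_fst_snd {f : ℝ → ℝ × ℝ} {v : ℝ × ℝ} {t : ℝ} (h : HasDerivAt f v t) :
    HasDerivAt (fun s => (f s).1) v.1 t ∧ HasDerivAt (fun s => (f s).2) v.2 t :=
  ⟨(hasFDerivAt_fst (𝕜 := ℝ) (p := f t)).comp_hasDerivAt t h,
    (hasFDerivAt_snd (𝕜 := ℝ) (p := f t)).comp_hasDerivAt t h⟩

theorem eq_of_hasDerivAt_zero {f : ℝ → ℝ} (h : ∀ t, HasDerivAt f 0 t) (t : ℝ) : f t = f 0 :=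
  is_const_of_deriv_eq_zero (fun s => (h s).differentiableAt) (fun s => (h s).deriv) t 0

/-- If the forced rotation system `p' = -q - m cos`, `q' = p - m sin` has a `2π`-periodic
solution then there is no resonant forcing. -/
theorem forcing_eq_zero_of_periodic {p q : ℝ → ℝ} {m : ℝ}
    (hp : ∀ t, HasDerivAt p (-q t - m * cos t) t) (hq : ∀ t, HasDerivAt q (p t - m * sin t) t)
    (hper : p (2 * π) = p 0) : m = 0 := by
  have hd : ∀ t, HasDerivAt (fun t => p t * cos t + q t * sin t + m * t) 0 t := by
    intro t
    refine ((((hp t).mul (hasDerivAt_cos t)).add ((hq t).mul (hasDerivAt_sin t))).add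
      ((hasDerivAt_id t).const_mul m)).congr_deriv ?_
    linear_combination -m * sin_sq_add_cos_sq t
  have h := eq_of_hasDerivAt_zero hd (2 * π)
  simp only [cos_two_pi, sin_two_pi, cos_zero, sin_zero, hper] at h
  have : m * π = 0 := by linarith
  exact (mul_eq_zero.mp this).resolve_right pi_ne_zero

/-- Solutions of `(x, y)'' = i (x, y)'` are circles. -/
theorem exists_circle_of_rotation {x y p q : ℝ → ℝ} (hx : ∀ t, HasDerivAt x (p t) t)
    (hy : ∀ t, HasDerivAt y (q t) t) (hp : ∀ t, HasDerivAt p (-q t) t)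
    (hq : ∀ t, HasDerivAt q (p t) t) :
    ∃ A B b c : ℝ, ∀ t, x t = A * sin t + B * cos t + b ∧ y t = -(A * cos t) + B * sin t + c := by
  have radial : ∀ t, HasDerivAt (fun t => p t * cos t + q t * sin t) 0 t := fun t =>
    (((hp t).mul (hasDerivAt_cos t)).add ((hq t).mul (hasDerivAt_sin t))).congr_deriv (by ring)
  have tangential : ∀ t, HasDerivAt (fun t => q t * cos t - p t * sin t) 0 t := fun t =>
    (((hq t).mul (hasDerivAt_cos t)).sub ((hp t).mul (hasDerivAt_sin t))).congr_deriv (by ring)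
  have first : ∀ t, HasDerivAt (fun t => x t - q t) 0 t := fun t =>
    ((hx t).sub (hq t)).congr_deriv (by ring)
  have second : ∀ t, HasDerivAt (fun t => y t + p t) 0 t := fun t =>
    ((hy t).add (hp t)).congr_deriv (by ring)
  refine ⟨p 0, q 0, x 0 - q 0, y 0 + p 0, fun t => ?_⟩
  have hr := eq_of_hasDerivAt_zero radial t
  have ht := eq_of_hasDerivAt_zero tangential t
  have h₁ := eq_of_hasDerivAt_zero first t
  have h₂ := eq_of_hasDerivAt_zero second t
  simp only [cos_zero, sin_zero, mul_one, mul_zero, add_zero, sub_zero] at hr ht h₁ h₂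
  constructor
  · linear_combination h₁ + sin t * hr + cos t * ht - q t * sin_sq_add_cos_sq t
  · linear_combination h₂ - cos t * hr + sin t * ht + p t * sin_sq_add_cos_sq t

/-- Euclidean nondegeneracy: the kernel of the linearization at `ω` of the
Euclidean constant-curvature-`k` loop equation, `φ ↦ -φ'' + iφ' - k²(⨍ φ·ω)ω`, is exactly
the span of `ω'`, `e₁`, `e₂`. -/
theorem stmt_19 (k : ℝ) (hk : 0 < k) (φ : ℝ → ℝ × ℝ)
    (hφ : ContDiff ℝ 2 φ) (hper : Function.Periodic φ (2 * π)) :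
    (∀ t : ℝ, -(deriv (deriv φ) t) + rot (deriv φ t)
        - (k ^ 2 * ((1 / (2 * π)) * ∫ s in (0:ℝ)..(2 * π), dotp (φ s) (omE k s)))
            • omE k t = 0) ↔
    ∃ a b c : ℝ, ∀ t : ℝ,
      φ t = a • deriv (omE k) t + b • (((1:ℝ), (0:ℝ)) : ℝ × ℝ)
          + c • (((0:ℝ), (1:ℝ)) : ℝ × ℝ) := by
  constructor
  · intro h
    have hd : ∀ t, HasDerivAt φ (deriv φ t) t := fun t =>
      (hφ.differentiable (by norm_num) t).hasDerivAt
    have hdd : ∀ t, HasDerivAt (deriv φ) (deriv (deriv φ) t) t := fun t =>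
      ((hφ.deriv' (n := 1)).differentiable (by norm_num) t).hasDerivAt
    have hper' : deriv φ (2 * π) = deriv φ 0 := by
      have := deriv_comp_add_const φ (2 * π) 0
      rw [funext hper, zero_add] at this
      exact this.symm
    set M := k ^ 2 * ((1 / (2 * π)) * ∫ s in (0:ℝ)..(2 * π), dotp (φ s) (omE k s)) with hM
    have hp : ∀ t, HasDerivAt (fun t => (deriv φ t).1)
        (-(deriv φ t).2 - M * (1 / k) * cos t) t := fun t =>
      (hasDerivAt_fst_snd (hdd t)).1.congr_deriv (by
        have := congrArg Prod.fst (h t)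
        simp only [rot, omE, Prod.fst_add, Prod.fst_sub, Prod.fst_neg, Prod.smul_fst,
          smul_eq_mul, Prod.fst_zero] at this
        linarith)
    have hq : ∀ t, HasDerivAt (fun t => (deriv φ t).2)
        ((deriv φ t).1 - M * (1 / k) * sin t) t := fun t =>
      (hasDerivAt_fst_snd (hdd t)).2.congr_deriv (by
        have := congrArg Prod.snd (h t)
        simp only [rot, omE, Prod.snd_add, Prod.snd_sub, Prod.snd_neg, Prod.smul_snd,
          smul_eq_mul, Prod.snd_zero] at this
        linarith)
    have hm := forcing_eq_zero_of_periodic hp hq (congrArg Prod.fst hper')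
    simp only [hm, zero_mul, sub_zero] at hp hq
    obtain ⟨A, B, b, c, hc⟩ :=
      exists_circle_of_rotation (fun t => (hasDerivAt_fst_snd (hd t)).1)
        (fun t => (hasDerivAt_fst_snd (hd t)).2) hp hq
    rw [hM, integral_dotp_omE k A B b c φ fun t => Prod.ext (hc t).1 (hc t).2] at hm
    have hB : B = 0 := by
      have hpi := pi_ne_zero
      field_simp at hm
      exact hm
    refine ⟨-(k * A), b, c, fun t => ?_⟩
    rw [(hasDerivAt_omE k t).deriv]
    ext
    · simp [(hc t).1, hB]
      field_simp
    · simp [(hc t).2, hB]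
      field_simp
  · rintro ⟨a, b, c, h⟩ t
    have hform : ∀ t, φ t = (-(a / k) * sin t + 0 * cos t + b,
        -(-(a / k) * cos t) + 0 * sin t + c) := by
      intro t
      rw [h t, (hasDerivAt_omE k t).deriv]
      ext <;> simp <;> ring
    rw [integral_dotp_omE k _ _ _ _ φ hform]
    have hd : deriv φ = fun t => (-(a / k) * cos t, -(a / k) * sin t) := by
      funext t
      rw [funext hform]
      refine HasDerivAt.deriv (HasDerivAt.prodMk ?_ ?_)
      · exact ((((hasDerivAt_sin t).const_mul (-(a / k))).add
          ((hasDerivAt_cos t).const_mul 0)).add_const b).congr_deriv (by ring)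
      · exact (((((hasDerivAt_cos t).const_mul (-(a / k))).neg).add
          ((hasDerivAt_sin t).const_mul 0)).add_const c).congr_deriv (by ring)
    have hdd : deriv (deriv φ) t = (-(a / k) * -sin t, -(a / k) * cos t) := by
      rw [hd]
      exact (((hasDerivAt_cos t).const_mul _).prodMk ((hasDerivAt_sin t).const_mul _)).deriv
    rw [hdd, hd]
    ext <;> simp [rot]
end
end
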